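/- arXiv:1307.8025 — 4 statements merged into one kernel-verified Lean document; each statement's English description precedes it below -/
import Mathlib

section
/- Let 1 < p < ∞ and 1 ≤ q < ∞ with q > 3p, let p' = p/(p−1), 𝔉(s) = Γ(s+1)/s^s and C₁(p,q) = 𝔉(1/q + 1/p') / (2 𝔉(1/q) 𝔉(1/p')). Then the sharp constant in the inequality (∫₀¹ |u − ∫₀¹ u dt|^q dx)^{1/q} ≤ C (∫₀¹ |u'|^p dx)^{1/p} over continuously differentiable u : [0,1] → ℝ is strictly greater than C₁(p,q); in particular there exists a continuously differentiable u : [0,1] → ℝ with ∫₀¹ u dx = 0 and (∫₀¹ |u|^q dx)^{1/q} > C₁(p,q) (∫₀¹ |u'|^p dx)^{1/p}. -/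
open Real MeasureTheory intervalIntegral Set

/-- `𝔉(s) = Γ(s+1)/s^s`. -/
noncomputable def frakF (s : ℝ) : ℝ := Real.Gamma (s + 1) / s ^ s

/-- Schmidt's sharp constant `C₁(p,q) = 𝔉(1/q + 1/p') / (2 𝔉(1/q) 𝔉(1/p'))`,
where `p' = p/(p-1)`. -/
noncomputable def schmidtC (p q : ℝ) : ℝ :=
  frakF (1 / q + 1 / (p / (p - 1))) / (2 * frakF (1 / q) * frakF (1 / (p / (p - 1))))

open Filter Topology

/-! ### Elementary inequalities for real powers -/

theorem hasDerivAt_abs_rpow_mul_self {s : ℝ} (hs : 1 < s) (x : ℝ) :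
    HasDerivAt (fun x : ℝ => |x| ^ s * x) ((s + 1) * |x| ^ s) x := by
  convert! (hasDerivAt_abs_rpow x hs).mul (hasDerivAt_id x) using 1
  rcases eq_or_ne x 0 with rfl | hx
  · simp [Real.zero_rpow (by linarith : s ≠ 0)]
  · have h : |x| ^ s = |x| ^ (s - 2) * (x * x) := by
      rw [← abs_mul_abs_self x, ← pow_two, ← Real.rpow_natCast, ← Real.rpow_add (abs_pos.2 hx)]
      norm_num
    rw [h]
    simp only [id]
    ring

theorem two_mul_abs_rpow_le_add {s : ℝ} (hs : 1 ≤ s) (a h : ℝ) :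
    2 * |a| ^ s ≤ |a + h| ^ s + |a - h| ^ s := by
  have hc := (convexOn_rpow hs).2 (abs_nonneg (a + h)) (abs_nonneg (a - h))
    (by norm_num : (0 : ℝ) ≤ 1 / 2) (by norm_num : (0 : ℝ) ≤ 1 / 2) (by norm_num)
  have ha : |a| ≤ 1 / 2 * |a + h| + 1 / 2 * |a - h| := by
    have := abs_add_le (a + h) (a - h)
    rw [show a + h + (a - h) = 2 * a by ring, abs_mul] at this
    norm_num at this
    linarith
  have hm := Real.rpow_le_rpow (abs_nonneg a) ha (by linarith : 0 ≤ s)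
  simp only [smul_eq_mul] at hc
  linarith

theorem two_mul_abs_rpow_add_le_of_nonneg {q : ℝ} (hq : 3 < q) (a : ℝ) {h : ℝ} (hh : 0 ≤ h) :
    2 * |a| ^ q + q * (q - 1) * |a| ^ (q - 2) * h ^ 2 ≤ |a + h| ^ q + |a - h| ^ q := by
  have hplus (x : ℝ) : HasDerivAt (fun x : ℝ => a + x) 1 x := (hasDerivAt_id x).const_add a
  have hminus (x : ℝ) : HasDerivAt (fun x : ℝ => a - x) (-1) x := (hasDerivAt_id x).const_sub a
  set G : ℝ → ℝ := fun x => |a + x| ^ (q - 2) * (a + x) - |a - x| ^ (q - 2) * (a - x)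
    - 2 * (q - 1) * |a| ^ (q - 2) * x with hG
  have hG' (x : ℝ) : HasDerivAt G
      ((q - 1) * (|a + x| ^ (q - 2) + |a - x| ^ (q - 2) - 2 * |a| ^ (q - 2))) x := by
    have h1 := (hasDerivAt_abs_rpow_mul_self (by linarith : 1 < q - 2) (a + x)).comp x (hplus x)
    have h2 := (hasDerivAt_abs_rpow_mul_self (by linarith : 1 < q - 2) (a - x)).comp x (hminus x)
    convert! (h1.sub h2).sub ((hasDerivAt_id x).const_mul (2 * (q - 1) * |a| ^ (q - 2))) using 1
    ring
  have hGmono : Monotone G := by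
    refine monotone_of_deriv_nonneg (fun x => (hG' x).differentiableAt) fun x => ?_
    rw [(hG' x).deriv]
    have := two_mul_abs_rpow_le_add (by linarith : 1 ≤ q - 2) a x
    exact mul_nonneg (by linarith) (by linarith)
  set F : ℝ → ℝ := fun x => |a + x| ^ q + |a - x| ^ q - q * (q - 1) * |a| ^ (q - 2) * x ^ 2 with hF
  have hF' (x : ℝ) : HasDerivAt F (q * G x) x := by
    have h1 := (hasDerivAt_abs_rpow (a + x) (by linarith : 1 < q)).comp x (hplus x)
    have h2 := (hasDerivAt_abs_rpow (a - x) (by linarith : 1 < q)).comp x (hminus x)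
    convert! (h1.add h2).sub ((hasDerivAt_pow 2 x).const_mul (q * (q - 1) * |a| ^ (q - 2))) using 1
    simp only [hG]
    push_cast
    ring
  have hFmono : MonotoneOn F (Ici 0) := by
    refine monotoneOn_of_deriv_nonneg (convex_Ici 0)
      (fun x _ => (hF' x).continuousAt.continuousWithinAt)
      (fun x _ => (hF' x).differentiableAt.differentiableWithinAt) fun x hx => ?_
    rw [(hF' x).deriv]
    rw [interior_Ici, mem_Ioi] at hx
    have h0 : G 0 = 0 := by simp [hG]
    exact mul_nonneg (by linarith) (h0 ▸ hGmono hx.le)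
  have := hFmono (mem_Ici.2 le_rfl) (mem_Ici.2 hh) hh
  simp only [hF, add_zero, sub_zero] at this
  norm_num at this
  linarith

theorem two_mul_abs_rpow_add_le {q : ℝ} (hq : 3 < q) (a h : ℝ) :
    2 * |a| ^ q + q * (q - 1) * |a| ^ (q - 2) * h ^ 2 ≤ |a + h| ^ q + |a - h| ^ q := by
  rcases le_total 0 h with hh | hh
  · exact two_mul_abs_rpow_add_le_of_nonneg hq a hh
  · have := two_mul_abs_rpow_add_le_of_nonneg hq a (neg_nonneg.2 hh)
    rw [neg_sq, sub_neg_eq_add, ← sub_eq_add_neg] at this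
    linarith

theorem exists_one_add_rpow_le {p c : ℝ} (hp : 1 < p) (hc : p * (p - 1) / 2 < c) :
    ∃ η > 0, η < 1 ∧ ∀ x : ℝ, |x| ≤ η → (1 + x) ^ p ≤ 1 + p * x + c * x ^ 2 := by
  have hcont : ContinuousAt (fun x : ℝ => p * (p - 1) * (1 + x) ^ (p - 2)) 0 := by
    refine continuousAt_const.mul (ContinuousAt.rpow_const (by fun_prop) (Or.inl ?_))
    norm_num
  have hev : ∀ᶠ x : ℝ in 𝓝 0, p * (p - 1) * (1 + x) ^ (p - 2) < 2 * c :=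
    hcont.eventually_lt continuousAt_const (by norm_num; linarith)
  obtain ⟨δ, hδ, hball⟩ := Metric.eventually_nhds_iff.1 hev
  refine ⟨min δ 1 / 2, by positivity, by have := min_le_right δ 1; linarith, ?_⟩
  set η := min δ 1 / 2 with hη
  have hη0 : 0 < η := by positivity
  have hη1 : η < 1 := by have := min_le_right δ 1; linarith
  have hηδ : η < δ := by have := min_le_left δ 1; linarith
  have hadd (x : ℝ) : HasDerivAt (fun x : ℝ => 1 + x) 1 x := (hasDerivAt_id x).const_add 1
  set g : ℝ → ℝ := fun x => p + 2 * c * x - p * (1 + x) ^ (p - 1) with hg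
  have hg' {x : ℝ} (hx : x ∈ Icc (-η) η) :
      HasDerivAt g (2 * c - p * (p - 1) * (1 + x) ^ (p - 2)) x := by
    have h1 := ((hadd x).rpow_const (p := p - 1)
      (Or.inl (by linarith [hx.1] : 1 + x ≠ 0) : 1 + x ≠ 0 ∨ _)).const_mul p
    convert! (((hasDerivAt_id x).const_mul (2 * c)).const_add p).sub h1 using 1
    rw [show p - 1 - 1 = p - 2 by ring]
    ring
  have hgmono : MonotoneOn g (Icc (-η) η) := by
    refine monotoneOn_of_deriv_nonneg (convex_Icc _ _)
      (fun x hx => (hg' hx).continuousAt.continuousWithinAt)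
      (fun x hx => (hg' (interior_subset hx)).differentiableAt.differentiableWithinAt)
      fun x hx => ?_
    have hx := interior_subset hx
    rw [(hg' hx).deriv]
    have := @hball x (by rw [Real.dist_eq, sub_zero]; exact (abs_le.2 hx).trans_lt hηδ)
    linarith
  have hg0 : g 0 = 0 := by simp [hg]
  set F : ℝ → ℝ := fun x => 1 + p * x + c * x ^ 2 - (1 + x) ^ p with hF
  have hF' {x : ℝ} (hx : x ∈ Icc (-η) η) : HasDerivAt F (g x) x := by
    have h1 := (hadd x).rpow_const (p := p) (Or.inr hp.le)
    convert! ((((hasDerivAt_id x).const_mul p).const_add 1).add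
      ((hasDerivAt_pow 2 x).const_mul c)).sub h1 using 1
    simp only [hg]
    push_cast
    ring
  have hF0 : F 0 = 0 := by simp [hF]
  have hzero : (0 : ℝ) ∈ Icc (-η) η := ⟨by linarith, hη0.le⟩
  have hposs : MonotoneOn F (Icc 0 η) := by
    have hsub : Icc 0 η ⊆ Icc (-η) η := Icc_subset_Icc_left (by linarith)
    refine monotoneOn_of_deriv_nonneg (convex_Icc _ _)
      (fun x hx => (hF' (hsub hx)).continuousAt.continuousWithinAt)
      (fun x hx => (hF' (hsub (interior_subset hx))).differentiableAt.differentiableWithinAt)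
      fun x hx => ?_
    have hx := interior_subset hx
    rw [(hF' (hsub hx)).deriv, ← hg0]
    exact hgmono hzero (hsub hx) hx.1
  have hnegs : AntitoneOn F (Icc (-η) 0) := by
    have hsub : Icc (-η) 0 ⊆ Icc (-η) η := Icc_subset_Icc_right (by linarith)
    refine antitoneOn_of_deriv_nonpos (convex_Icc _ _)
      (fun x hx => (hF' (hsub hx)).continuousAt.continuousWithinAt)
      (fun x hx => (hF' (hsub (interior_subset hx))).differentiableAt.differentiableWithinAt)
      fun x hx => ?_
    have hx := interior_subset hx
    rw [(hF' (hsub hx)).deriv, ← hg0]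
    exact hgmono (hsub hx) hzero hx.2
  intro x hx
  have hx := abs_le.1 hx
  have : 0 ≤ F x := by
    rw [← hF0]
    rcases le_total 0 x with h | h
    · exact hposs ⟨le_rfl, hη0.le⟩ ⟨h, hx.2⟩ h
    · exact hnegs ⟨hx.1, h⟩ ⟨by linarith, le_rfl⟩ h
  simp only [hF] at this
  linarith

theorem eventually_one_add_mul_rpow_lt {a b α β : ℝ} (h : a * α < b * β) :
    ∀ᶠ s : ℝ in 𝓝[>] 0, (1 + a * s) ^ α < (1 + b * s) ^ β := by
  have hd (a α : ℝ) : HasDerivAt (fun s : ℝ => (1 + a * s) ^ α) (a * α) 0 := by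
    have h1 : HasDerivAt (fun s : ℝ => 1 + a * s) a 0 := by
      simpa using ((hasDerivAt_id (0 : ℝ)).const_mul a).const_add 1
    simpa using h1.rpow_const (p := α) (Or.inl (by norm_num))
  have hs := hasDerivAt_iff_tendsto_slope.1 ((hd b β).sub (hd a α))
  have hpos : ∀ᶠ s : ℝ in 𝓝[>] 0, 0 < slope
      ((fun s : ℝ => (1 + b * s) ^ β) - fun s : ℝ => (1 + a * s) ^ α) 0 s :=
    (hs.mono_left (nhdsWithin_mono 0 (by intro x hx; exact ne_of_gt hx))).eventually
      (lt_mem_nhds (by linarith))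
  filter_upwards [hpos, self_mem_nhdsWithin] with s hs hs0
  rw [slope_def_field] at hs
  have hs0 : 0 < s := hs0
  have := (div_pos_iff_of_pos_right (by linarith : 0 < s - 0)).1 hs
  simp at this
  linarith

/-! ### The inequality with constant one -/

theorem integral_eq_sub_of_hasDerivWithinAt_Icc {u u' : ℝ → ℝ}
    (hu : ∀ x ∈ Icc (0 : ℝ) 1, HasDerivWithinAt u (u' x) (Icc (0 : ℝ) 1) x)
    (hu' : ContinuousOn u' (Icc (0 : ℝ) 1)) {a b : ℝ} (ha : 0 ≤ a) (hab : a ≤ b) (hb : b ≤ 1) :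
    ∫ t in a..b, u' t = u b - u a := by
  have hsub : Icc a b ⊆ Icc 0 1 := Icc_subset_Icc ha hb
  refine integral_eq_sub_of_hasDerivAt_of_le hab
    (fun x hx => (hu x (hsub hx)).continuousWithinAt.mono hsub) (fun x hx => ?_)
    ((hu'.mono (by rwa [uIcc_of_le hab])).intervalIntegrable)
  exact (hu x (hsub (Ioo_subset_Icc_self hx))).hasDerivAt
    (Icc_mem_nhds (by linarith [hx.1]) (by linarith [hx.2]))

theorem rpow_integral_abs_sub_integral_le {p q : ℝ} (hp : 1 < p) (hq : 1 ≤ q) {u u' : ℝ → ℝ}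
    (hu : ∀ x ∈ Icc (0 : ℝ) 1, HasDerivWithinAt u (u' x) (Icc (0 : ℝ) 1) x)
    (hu' : ContinuousOn u' (Icc (0 : ℝ) 1)) :
    (∫ x in (0 : ℝ)..1, |u x - ∫ t in (0 : ℝ)..1, u t| ^ q) ^ (1 / q) ≤
      (∫ x in (0 : ℝ)..1, |u' x| ^ p) ^ (1 / p) := by
  have hI : uIcc (0 : ℝ) 1 = Icc 0 1 := uIcc_of_le zero_le_one
  have huc : ContinuousOn u (Icc 0 1) := fun x hx => (hu x hx).continuousWithinAt
  have hui : IntervalIntegrable u volume 0 1 := (huc.mono hI.le).intervalIntegrable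
  have habsi : IntervalIntegrable (fun t => |u' t|) volume 0 1 :=
    (hu'.abs.mono hI.le).intervalIntegrable
  have hpowi : IntervalIntegrable (fun t => |u' t| ^ p) volume 0 1 :=
    ((hu'.abs.rpow_const fun _ _ => Or.inr (by linarith)).mono hI.le).intervalIntegrable
  set K := ∫ t in (0 : ℝ)..1, |u' t| with hK
  have hK0 : 0 ≤ K := integral_nonneg zero_le_one fun _ _ => abs_nonneg _
  have hosc' {a b : ℝ} (ha : 0 ≤ a) (hab : a ≤ b) (hb : b ≤ 1) : |u b - u a| ≤ K := by
    rw [← integral_eq_sub_of_hasDerivWithinAt_Icc hu hu' ha hab hb]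
    refine (abs_integral_le_integral_abs hab).trans ?_
    exact integral_mono_interval ha hab hb (.of_forall fun _ => abs_nonneg _) habsi
  have hosc {a b : ℝ} (ha : a ∈ Icc (0 : ℝ) 1) (hb : b ∈ Icc (0 : ℝ) 1) : |u b - u a| ≤ K := by
    rcases le_total a b with h | h
    · exact hosc' ha.1 h hb.2
    · rw [abs_sub_comm]
      exact hosc' hb.1 h ha.2
  have hmean {x : ℝ} (hx : x ∈ Icc (0 : ℝ) 1) : |u x - ∫ t in (0 : ℝ)..1, u t| ≤ K := by
    have h1 : u x - ∫ t in (0 : ℝ)..1, u t = ∫ t in (0 : ℝ)..1, (u x - u t) := by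
      rw [intervalIntegral.integral_sub (by simp) hui]
      simp
    rw [h1]
    have := norm_integral_le_of_norm_le_const (a := (0 : ℝ)) (b := 1) (f := fun t => u x - u t)
      (C := K) fun t ht => by
        rw [uIoc_of_le zero_le_one] at ht
        exact hosc (Ioc_subset_Icc_self ht) hx
    simpa using this
  have hleft : (∫ x in (0 : ℝ)..1, |u x - ∫ t in (0 : ℝ)..1, u t| ^ q) ^ (1 / q) ≤ K := by
    have h1 : ∫ x in (0 : ℝ)..1, |u x - ∫ t in (0 : ℝ)..1, u t| ^ q ≤ K ^ q := by
      have := integral_mono_on (a := (0 : ℝ)) (b := 1) (μ := volume)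
        (f := fun x => |u x - ∫ t in (0 : ℝ)..1, u t| ^ q) (g := fun _ => K ^ q) zero_le_one
        (((huc.sub continuousOn_const).abs.rpow_const
          fun _ _ => Or.inr (by linarith)).mono hI.le).intervalIntegrable
        (by simp) fun x hx => Real.rpow_le_rpow (abs_nonneg _) (hmean hx) (by linarith)
      simpa using this
    calc _ ≤ (K ^ q) ^ (1 / q) := Real.rpow_le_rpow
          (integral_nonneg zero_le_one fun _ _ => Real.rpow_nonneg (abs_nonneg _) _) h1
          (by positivity)
      _ = K := by rw [← Real.rpow_mul hK0, mul_one_div_cancel (by linarith), Real.rpow_one]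
  refine hleft.trans ?_
  have hprob : IsProbabilityMeasure (volume.restrict (Ioc (0 : ℝ) 1)) := ⟨by simp⟩
  have hjensen : K ^ p ≤ ∫ t in (0 : ℝ)..1, |u' t| ^ p := by
    rw [hK, integral_of_le zero_le_one, integral_of_le zero_le_one]
    exact (convexOn_rpow hp.le).map_integral_le
      (continuousOn_id.rpow_const fun _ _ => Or.inr (by linarith)) isClosed_Ici
      (.of_forall fun _ => mem_Ici.2 (abs_nonneg _)) habsi.1 hpowi.1
  calc K = (K ^ p) ^ (1 / p) := by
        rw [← Real.rpow_mul hK0, mul_one_div_cancel (by linarith), Real.rpow_one]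
    _ ≤ _ := Real.rpow_le_rpow (by positivity) hjensen (by positivity)

/-! ### Transport of test functions from a weighted interval -/

theorem hasDerivWithinAt_Icc_of_Ioo {u u' : ℝ → ℝ} (hu : ContinuousOn u (Icc 0 1))
    (hd : ∀ x ∈ Ioo (0 : ℝ) 1, HasDerivAt u (u' x) x) (hu' : ContinuousOn u' (Icc 0 1)) :
    ∀ x ∈ Icc (0 : ℝ) 1, HasDerivWithinAt u (u' x) (Icc (0 : ℝ) 1) x := by
  have hprim : ∀ x ∈ Icc (0 : ℝ) 1, u x = u 0 + ∫ t in (0 : ℝ)..x, u' t := by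
    intro x hx
    rw [integral_eq_sub_of_hasDerivAt_of_le hx.1 (hu.mono (Icc_subset_Icc_right hx.2))
      (fun y hy => hd y ⟨hy.1, hy.2.trans_le hx.2⟩)
      ((hu'.mono (by rw [uIcc_of_le hx.1]; exact Icc_subset_Icc_right hx.2)).intervalIntegrable)]
    ring
  intro x hx
  have : Fact (x ∈ Icc (0 : ℝ) 1) := ⟨hx⟩
  have hF : HasDerivWithinAt (fun y => u 0 + ∫ t in (0 : ℝ)..y, u' t) (u' x) (Icc 0 1) x := by
    refine HasDerivWithinAt.const_add _ (integral_hasDerivWithinAt_right (t := Icc 0 1)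
      ((hu'.mono (by rw [uIcc_of_le hx.1]; exact Icc_subset_Icc_right hx.2)).intervalIntegrable)
      ?_ (hu' x hx))
    exact hu'.stronglyMeasurableAtFilter_nhdsWithin measurableSet_Icc x
  exact hF.congr hprim (hprim x hx)

theorem exists_transport {ρ V K : ℝ → ℝ} (hρc : ContinuousOn ρ (Ioo (-1) 1))
    (hρpos : ∀ v ∈ Ioo (-1 : ℝ) 1, 0 < ρ v) (hρi : IntegrableOn ρ (Ioo (-1) 1))
    (hρ1 : ∫ v in Ioo (-1 : ℝ) 1, ρ v = 1) (hV : ContinuousOn V (Icc (-1) 1))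
    (hK : ContinuousOn K (Icc (-1) 1))
    (hVK : ∀ v ∈ Ioo (-1 : ℝ) 1, HasDerivAt V (K v * ρ v) v) :
    ∃ u u' : ℝ → ℝ,
      (∀ x ∈ Icc (0 : ℝ) 1, HasDerivWithinAt u (u' x) (Icc (0 : ℝ) 1) x) ∧
      ContinuousOn u' (Icc (0 : ℝ) 1) ∧
      (∀ H : ℝ → ℝ, ∫ x in (0 : ℝ)..1, H (u x) = ∫ v in Ioo (-1 : ℝ) 1, H (V v) * ρ v) ∧
      ∀ H : ℝ → ℝ, ∫ x in (0 : ℝ)..1, H (u' x) = ∫ v in Ioo (-1 : ℝ) 1, H (K v) * ρ v := by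
  classical
  set τ : ℝ → ℝ := (Ioo (-1 : ℝ) 1).piecewise ρ 1 with hτ
  have hτpos (v : ℝ) : 0 < τ v := by
    by_cases hv : v ∈ Ioo (-1 : ℝ) 1
    · simpa [hτ, hv] using hρpos v hv
    · simp only [hτ, Set.piecewise_eq_of_notMem _ _ _ hv, Pi.one_apply, zero_lt_one]
  have hτeq {v : ℝ} (hv : v ∈ Ioo (-1 : ℝ) 1) : τ v = ρ v := Set.piecewise_eq_of_mem _ _ _ hv
  have hτi (a b : ℝ) : IntervalIntegrable τ volume a b := by
    rw [intervalIntegrable_iff, IntegrableOn, ← integrableOn_univ, ← Set.union_compl_self (Ioo (-1 : ℝ) 1)]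
    refine IntegrableOn.union ?_ ?_
    · refine ((hρi.congr_fun (fun v hv => (hτeq hv).symm) measurableSet_Ioo)).mono_measure
        Measure.restrict_le_self
    · refine IntegrableOn.congr_fun (f := fun _ => (1 : ℝ)) ?_ (fun v hv => by
        rw [hτ, Set.piecewise_eq_of_notMem _ _ _ hv, Pi.one_apply]) measurableSet_Ioo.compl
      exact (integrableOn_const (s := uIoc a b) (by simp [uIoc])).integrable.integrableOn
  set X : ℝ → ℝ := fun v => ∫ s in (-1 : ℝ)..v, τ s with hX
  have hXsub (a b : ℝ) : X b - X a = ∫ s in a..b, τ s := integral_interval_sub_left (hτi _ _) (hτi _ _)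
  have hXmono : StrictMono X := fun a b hab => by
    have := intervalIntegral_pos_of_pos (hτi a b) hτpos hab
    rw [← hXsub] at this
    linarith
  have hX0 : X (-1) = 0 := by simp [hX]
  have hX1 : X 1 = 1 := by
    simp only [hX]
    rw [integral_of_le (by norm_num), integral_Ioc_eq_integral_Ioo]
    refine Eq.trans ?_ hρ1
    exact setIntegral_congr_fun measurableSet_Ioo fun v hv => hτeq hv
  have hXcont : Continuous X := continuous_primitive hτi _
  have hXge {v : ℝ} (hv : 1 ≤ v) : X v = v := by
    have h1 : ∫ s in (1 : ℝ)..v, τ s = ∫ s in (1 : ℝ)..v, (1 : ℝ) := by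
      refine integral_congr fun s hs => ?_
      rw [uIcc_of_le hv] at hs
      exact Set.piecewise_eq_of_notMem _ _ _ fun h => by linarith [h.2, hs.1]
    rw [← hXsub, hX1] at h1
    simp at h1
    linarith
  have hXle {v : ℝ} (hv : v ≤ -1) : X v = v + 1 := by
    have h1 : ∫ s in v..(-1 : ℝ), τ s = ∫ s in v..(-1 : ℝ), (1 : ℝ) := by
      refine integral_congr fun s hs => ?_
      rw [uIcc_of_le hv] at hs
      exact Set.piecewise_eq_of_notMem _ _ _ fun h => by linarith [h.1, hs.2]
    rw [← hXsub, hX0] at h1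
    simp at h1
    linarith
  have hXsurj : Function.Surjective X := by
    refine hXcont.surjective ?_ ?_
    · refine tendsto_id.congr' ?_
      filter_upwards [eventually_ge_atTop 1] with v hv using (hXge hv).symm
    · refine (tendsto_atBot_add_const_right _ 1 tendsto_id).congr' ?_
      filter_upwards [eventually_le_atBot (-1)] with v hv using (hXle hv).symm
  let e : ℝ ≃o ℝ := hXmono.orderIsoOfSurjective X hXsurj
  have he (v : ℝ) : e v = X v := rfl
  have hXderiv {v : ℝ} (hv : v ∈ Ioo (-1 : ℝ) 1) : HasDerivAt X (ρ v) v := by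
    have hτc : ContinuousOn τ (Ioo (-1) 1) := hρc.congr fun v hv => hτeq hv
    rw [← hτeq hv]
    exact integral_hasDerivAt_right (hτi _ _)
      (hτc.stronglyMeasurableAtFilter isOpen_Ioo v hv) (hτc.continuousAt (isOpen_Ioo.mem_nhds hv))
  have he0 : e (-1) = 0 := hX0
  have he1 : e 1 = 1 := hX1
  have himage : X '' Ioo (-1) 1 = Ioo 0 1 := by
    have := e.image_Ioo (-1) 1
    rwa [he0, he1] at this
  have hmapsIcc : MapsTo e.symm (Icc 0 1) (Icc (-1) 1) := fun x hx => by
    constructor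
    · rw [e.le_symm_apply, he0]; exact hx.1
    · rw [e.symm_apply_le, he1]; exact hx.2
  have hmapsIoo : MapsTo e.symm (Ioo 0 1) (Ioo (-1) 1) := fun x hx => by
    constructor
    · rw [e.lt_symm_apply, he0]; exact hx.1
    · rw [e.symm_apply_lt, he1]; exact hx.2
  have hchange (F : ℝ → ℝ) (H : ℝ → ℝ) : ∫ x in (0 : ℝ)..1, H (F (e.symm x)) =
      ∫ v in Ioo (-1 : ℝ) 1, H (F v) * ρ v := by
    rw [integral_of_le zero_le_one, integral_Ioc_eq_integral_Ioo, ← himage,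
      integral_image_eq_integral_abs_deriv_smul measurableSet_Ioo
        (fun v hv => (hXderiv hv).hasDerivWithinAt) hXmono.injective.injOn]
    refine setIntegral_congr_fun measurableSet_Ioo fun v hv => ?_
    have : e.symm (X v) = v := e.symm_apply_apply v
    simp only [this, abs_of_pos (hρpos v hv), smul_eq_mul, mul_comm]
  have hsymm : Continuous e.symm := e.symm.continuous
  refine ⟨fun x => V (e.symm x), fun x => K (e.symm x), ?_, ?_, hchange V, hchange K⟩
  · refine hasDerivWithinAt_Icc_of_Ioo (hV.comp hsymm.continuousOn hmapsIcc) (fun x hx => ?_)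
      (hK.comp hsymm.continuousOn hmapsIcc)
    have hv := hmapsIoo hx
    have hpos := hρpos _ hv
    have hU : HasDerivAt e.symm (ρ (e.symm x))⁻¹ x :=
      HasDerivAt.of_local_left_inverse hsymm.continuousAt (hXderiv hv) hpos.ne'
        (.of_forall fun y => e.apply_symm_apply y)
    convert! (hVK _ hv).comp x hU using 1
    field_simp
  · exact hK.comp hsymm.continuousOn hmapsIcc

/-! ### The normalising integral as a beta function -/

theorem integral_Ioo_eq_beta {a b : ℝ} (ha : 0 < a) (hb : 0 < b) :
    ∫ y in Ioo (0 : ℝ) 1, y ^ (a - 1) * (1 - y) ^ (b - 1) =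
      Real.Gamma a * Real.Gamma b / Real.Gamma (a + b) := by
  have h := ProbabilityTheory.beta_eq_betaIntegralReal a b ha hb
  have h2 : Complex.betaIntegral a b =
      ((∫ y in Ioo (0 : ℝ) 1, y ^ (a - 1) * (1 - y) ^ (b - 1) : ℝ) : ℂ) := by
    rw [Complex.betaIntegral, integral_of_le zero_le_one, integral_Ioc_eq_integral_Ioo,
      ← integral_complex_ofReal]
    refine setIntegral_congr_fun measurableSet_Ioo fun y hy => ?_
    rw [Complex.ofReal_mul, Complex.ofReal_cpow hy.1.le, Complex.ofReal_cpow (by linarith [hy.2])]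
    norm_num
  rw [h2, Complex.ofReal_re] at h
  exact h.symm

theorem integral_one_sub_abs_rpow_rpow {q r : ℝ} (hq : 0 < q) (hr : r < 1) :
    ∫ v in Ioo (-1 : ℝ) 1, (1 - |v| ^ q) ^ (-r) =
      2 * (1 / q * (Real.Gamma (1 / q) * Real.Gamma (1 - r) / Real.Gamma (1 / q + (1 - r)))) := by
  set f : ℝ → ℝ := (Iio (1 : ℝ)).indicator fun x => (1 - x ^ q) ^ (-r) with hf
  have h1 : ∫ v in Ioo (-1 : ℝ) 1, (1 - |v| ^ q) ^ (-r) = ∫ v : ℝ, f |v| := by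
    rw [← MeasureTheory.integral_indicator measurableSet_Ioo]
    refine integral_congr_ae (.of_forall fun v => ?_)
    simp only [hf, Set.indicator_apply, mem_Iio, mem_Ioo, ← abs_lt]
  have h2 : ∫ x in Ioi (0 : ℝ), f x = ∫ x in Ioi (0 : ℝ), (|q| * x ^ (q - 1)) •
      (Iio (1 : ℝ)).indicator (fun y => 1 / q * (y ^ (1 / q - 1) * (1 - y) ^ (1 - r - 1))) (x ^ q) := by
    refine setIntegral_congr_fun measurableSet_Ioi fun x hx => ?_
    have hx : 0 < x := hx
    simp only [hf, Set.indicator_apply, mem_Iio, Real.rpow_lt_one_iff_of_pos hx, smul_eq_mul,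
      abs_of_pos hq]
    by_cases hx1 : x < 1
    · rw [if_pos hx1, if_pos (Or.inr ⟨hx1, hq⟩), ← Real.rpow_mul hx.le,
        show q * (1 / q - 1) = -(q - 1) by field_simp; ring, Real.rpow_neg hx.le,
        show 1 - r - 1 = -r by ring]
      have := Real.rpow_pos_of_pos hx (q - 1)
      field_simp
    · rw [if_neg hx1, if_neg (by rintro (h | h) <;> [linarith [h.2]; linarith [h.1]]), mul_zero]
  rw [h1, integral_comp_abs, h2, integral_comp_rpow_Ioi _ hq.ne',
    setIntegral_indicator measurableSet_Iio, Ioi_inter_Iio, MeasureTheory.integral_const_mul,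
    integral_Ioo_eq_beta (by positivity) (by linarith)]

/-! ### The weight `1 - |v|^q` and its tail integral -/

/-- The weight `1 - |v|^q`. -/
noncomputable def weight (q v : ℝ) : ℝ := 1 - |v| ^ q

/-- The tail integral of `s (1 - |s|^q)^(-r)` over `[v, 1]`. -/
noncomputable def tail (q r v : ℝ) : ℝ := ∫ s in v..1, s * weight q s ^ (-r)

theorem weight_neg (q v : ℝ) : weight q (-v) = weight q v := by simp [weight]

theorem weight_pos {q v : ℝ} (hq : 0 < q) (hv : v ∈ Ioo (-1 : ℝ) 1) : 0 < weight q v :=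
  sub_pos.2 (Real.rpow_lt_one (abs_nonneg v) (abs_lt.2 hv) hq)

theorem weight_nonneg {q v : ℝ} (hq : 0 < q) (hv : v ∈ Icc (-1 : ℝ) 1) : 0 ≤ weight q v :=
  sub_nonneg.2 (Real.rpow_le_one (abs_nonneg v) (abs_le.2 hv) hq.le)

theorem weight_one (q : ℝ) : weight q 1 = 0 := by simp [weight]

theorem weight_neg_one (q : ℝ) : weight q (-1) = 0 := by simp [weight]

theorem continuous_weight {q : ℝ} (hq : 0 < q) : Continuous (weight q) :=
  continuous_const.sub (continuous_abs.rpow_const fun _ => Or.inr hq.le)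

theorem continuousOn_weight_rpow {q : ℝ} (hq : 0 < q) (s : ℝ) :
    ContinuousOn (fun v => weight q v ^ s) (Ioo (-1) 1) :=
  (continuous_weight hq).continuousOn.rpow_const fun _ hv => Or.inl (weight_pos hq hv).ne'

theorem continuous_weight_rpow {q s : ℝ} (hq : 0 < q) (hs : 0 ≤ s) :
    Continuous (fun v => weight q v ^ s) :=
  (continuous_weight hq).rpow_const fun _ => Or.inr hs

theorem hasDerivAt_weight {q : ℝ} (hq : 1 < q) (v : ℝ) :
    HasDerivAt (weight q) (-(q * |v| ^ (q - 2) * v)) v :=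
  (hasDerivAt_abs_rpow v hq).const_sub 1

theorem abs_rpow_sub_two_mul_sq {q : ℝ} (hq : 2 < q) (v : ℝ) :
    |v| ^ (q - 2) * v ^ 2 = |v| ^ q := by
  rcases eq_or_ne v 0 with rfl | hv
  · simp [Real.zero_rpow (by linarith : q ≠ 0)]
  · rw [← sq_abs, ← Real.rpow_natCast, ← Real.rpow_add (abs_pos.2 hv)]
    norm_num

theorem hasDerivAt_weight_rpow {q : ℝ} (hq : 1 < q) (s : ℝ) {v : ℝ} (hv : v ∈ Ioo (-1 : ℝ) 1) :
    HasDerivAt (fun v => weight q v ^ s)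
      (-(q * |v| ^ (q - 2) * v) * s * weight q v ^ (s - 1)) v :=
  (hasDerivAt_weight hq v).rpow_const (Or.inl (weight_pos (by linarith) hv).ne')

theorem one_sub_abs_le_weight {q v : ℝ} (hq : 1 ≤ q) (hv : v ∈ Ioo (-1 : ℝ) 1) :
    1 - |v| ≤ weight q v := by
  have := Real.rpow_le_rpow_of_exponent_ge' (abs_nonneg v) (abs_lt.2 hv).le zero_le_one hq
  rw [Real.rpow_one] at this
  unfold weight
  linarith

theorem integrableOn_weight_rpow {q r : ℝ} (hq : 1 ≤ q) (hr0 : 0 ≤ r) (hr : r < 1) :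
    IntegrableOn (fun v => weight q v ^ (-r)) (Ioo (-1) 1) := by
  have h0 (a b : ℝ) : IntervalIntegrable (fun x : ℝ => x ^ (-r)) volume a b :=
    intervalIntegrable_rpow' (by linarith)
  have h1 : IntegrableOn (fun v : ℝ => (1 - v) ^ (-r)) (Ioo (-1) 1) := by
    have := (h0 2 0).comp_sub_left 1
    norm_num at this
    exact ((intervalIntegrable_iff_integrableOn_Ioo_of_le (by norm_num)).1 this)
  have h2 : IntegrableOn (fun v : ℝ => (1 + v) ^ (-r)) (Ioo (-1) 1) := by
    have := (h0 0 2).comp_add_left 1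
    norm_num at this
    exact ((intervalIntegrable_iff_integrableOn_Ioo_of_le (by norm_num)).1 this)
  refine (h1.add h2).mono' ((continuousOn_weight_rpow (by linarith) _).aestronglyMeasurable
    measurableSet_Ioo) ((ae_restrict_iff' measurableSet_Ioo).2 (.of_forall fun v hv => ?_))
  have hw := weight_pos (q := q) (by linarith) hv
  have hv1 : 0 < 1 - |v| := sub_pos.2 (abs_lt.2 hv)
  rw [Real.norm_of_nonneg (Real.rpow_nonneg hw.le _)]
  refine (Real.rpow_le_rpow_of_nonpos hv1 (one_sub_abs_le_weight hq hv) (by linarith)).trans ?_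
  have hp1 : 0 ≤ (1 - v) ^ (-r) := Real.rpow_nonneg (by linarith [hv.2]) _
  have hp2 : 0 ≤ (1 + v) ^ (-r) := Real.rpow_nonneg (by linarith [hv.1]) _
  simp only [Pi.add_apply]
  rcases abs_cases v with ⟨h, _⟩ | ⟨h, _⟩ <;> rw [h]
  · linarith
  · rw [sub_neg_eq_add]
    linarith

theorem integrableOn_mul_weight_rpow {q r : ℝ} (hq : 1 ≤ q) (hr0 : 0 ≤ r) (hr : r < 1)
    {f : ℝ → ℝ} (hf : ContinuousOn f (Ioo (-1) 1)) {C : ℝ} (hC : ∀ v ∈ Ioo (-1 : ℝ) 1, |f v| ≤ C) :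
    IntegrableOn (fun v => f v * weight q v ^ (-r)) (Ioo (-1) 1) :=
  (integrableOn_weight_rpow hq hr0 hr).bdd_mul (hf.aestronglyMeasurable measurableSet_Ioo)
    ((ae_restrict_iff' measurableSet_Ioo).2 (.of_forall hC))

theorem integrableOn_mul_weight_rpow_of_continuousOn_Icc {q r : ℝ} (hq : 1 ≤ q) (hr0 : 0 ≤ r)
    (hr : r < 1) {f : ℝ → ℝ} (hf : ContinuousOn f (Icc (-1) 1)) :
    IntegrableOn (fun v => f v * weight q v ^ (-r)) (Ioo (-1) 1) := by
  obtain ⟨C, hC⟩ := isCompact_Icc.exists_bound_of_continuousOn hf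
  exact integrableOn_mul_weight_rpow hq hr0 hr (hf.mono Ioo_subset_Icc_self)
    fun v hv => hC v (Ioo_subset_Icc_self hv)

theorem integral_Ioo_deriv_eq_zero {f f' : ℝ → ℝ} (hf : ContinuousOn f (Icc (-1) 1))
    (hd : ∀ v ∈ Ioo (-1 : ℝ) 1, HasDerivAt f (f' v) v) (hi : IntegrableOn f' (Ioo (-1) 1))
    (hend : f 1 = f (-1)) : ∫ v in Ioo (-1 : ℝ) 1, f' v = 0 := by
  rw [← integral_Ioc_eq_integral_Ioo, ← integral_of_le (by norm_num),
    integral_eq_sub_of_hasDerivAt_of_le (by norm_num) hf hd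
      ((intervalIntegrable_iff_integrableOn_Ioo_of_le (by norm_num)).2 hi), hend, sub_self]

theorem integral_Ioo_comp_neg (f : ℝ → ℝ) :
    ∫ v in Ioo (-1 : ℝ) 1, f (-v) = ∫ v in Ioo (-1 : ℝ) 1, f v := by
  rw [← integral_Ioc_eq_integral_Ioo, ← integral_Ioc_eq_integral_Ioo,
    ← integral_of_le (by norm_num), ← integral_of_le (by norm_num), integral_comp_neg, neg_neg]

theorem integral_Ioo_eq_zero_of_odd {f : ℝ → ℝ} (hf : ∀ v, f (-v) = -f v) :
    ∫ v in Ioo (-1 : ℝ) 1, f v = 0 := by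
  have h := integral_Ioo_comp_neg f
  simp only [hf, MeasureTheory.integral_neg] at h
  linarith

theorem intervalIntegrable_tail {q r : ℝ} (hq : 1 ≤ q) (hr0 : 0 ≤ r) (hr : r < 1) :
    IntervalIntegrable (fun s => s * weight q s ^ (-r)) volume (-1) 1 :=
  (intervalIntegrable_iff_integrableOn_Ioo_of_le (by norm_num)).2
    (integrableOn_mul_weight_rpow_of_continuousOn_Icc hq hr0 hr continuousOn_id)

theorem tail_one (q r : ℝ) : tail q r 1 = 0 := by simp [tail]

theorem tail_neg {q r : ℝ} (hq : 1 ≤ q) (hr0 : 0 ≤ r) (hr : r < 1) {v : ℝ}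
    (hv : v ∈ Icc (-1 : ℝ) 1) : tail q r (-v) = tail q r v := by
  have hi := intervalIntegrable_tail hq hr0 hr
  have hsub {a b : ℝ} (ha : a ∈ Icc (-1 : ℝ) 1) (hb : b ∈ Icc (-1 : ℝ) 1) :
      IntervalIntegrable (fun s => s * weight q s ^ (-r)) volume a b :=
    hi.mono_set (by
      rw [uIcc_of_le (by norm_num : (-1 : ℝ) ≤ 1)]
      exact uIcc_subset_Icc ha hb)
  have hv' : -v ∈ Icc (-1 : ℝ) 1 := ⟨by linarith [hv.2], by linarith [hv.1]⟩
  have hodd : ∫ s in (-v)..v, s * weight q s ^ (-r) = 0 := by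
    have h := integral_comp_neg (a := -v) (b := v) (fun s => s * weight q s ^ (-r))
    simp only [weight_neg, neg_mul, intervalIntegral.integral_neg, neg_neg] at h
    linarith
  have := integral_add_adjacent_intervals (hsub hv' hv) (hsub hv ⟨by norm_num, le_rfl⟩)
  rw [hodd, zero_add] at this
  exact this.symm

theorem tail_neg_one {q r : ℝ} (hq : 1 ≤ q) (hr0 : 0 ≤ r) (hr : r < 1) : tail q r (-1) = 0 := by
  rw [tail_neg hq hr0 hr ⟨by norm_num, le_rfl⟩, tail_one]

theorem continuousOn_tail {q r : ℝ} (hq : 1 ≤ q) (hr0 : 0 ≤ r) (hr : r < 1) :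
    ContinuousOn (tail q r) (Icc (-1) 1) := by
  have hi := intervalIntegrable_tail hq hr0 hr
  have h := continuousOn_primitive_interval_left (a := (-1 : ℝ)) (b := 1) (μ := volume)
    (f := fun s => s * weight q s ^ (-r)) (by
      rw [uIcc_of_le (by norm_num)]
      exact (intervalIntegrable_iff_integrableOn_Icc_of_le (by norm_num)).1 hi)
  rwa [uIcc_of_le (by norm_num)] at h

theorem hasDerivAt_tail {q r : ℝ} (hq : 1 ≤ q) (hr0 : 0 ≤ r) (hr : r < 1) {v : ℝ}
    (hv : v ∈ Ioo (-1 : ℝ) 1) : HasDerivAt (tail q r) (-(v * weight q v ^ (-r))) v := by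
  have hc : ContinuousOn (fun s => s * weight q s ^ (-r)) (Ioo (-1) 1) :=
    continuousOn_id.mul (continuousOn_weight_rpow (by linarith) _)
  refine integral_hasDerivAt_left ((intervalIntegrable_tail hq hr0 hr).mono_set ?_)
    (hc.stronglyMeasurableAtFilter isOpen_Ioo v hv) (hc.continuousAt (isOpen_Ioo.mem_nhds hv))
  rw [uIcc_of_le (by norm_num : (-1 : ℝ) ≤ 1)]
  exact uIcc_subset_Icc (Ioo_subset_Icc_self hv) ⟨by norm_num, le_rfl⟩

theorem abs_rpow_mul_abs_tail_le {q r : ℝ} (hq : 2 < q) (hr0 : 0 ≤ r) (hr : r < 1) {v : ℝ}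
    (hv : v ∈ Ioo (-1 : ℝ) 1) :
    |v| ^ (q - 1) * |tail q r v| ≤ weight q v ^ (1 - r) / (q * (1 - r)) := by
  wlog h0 : 0 ≤ v generalizing v
  · have := this (v := -v) ⟨by linarith [hv.2], by linarith [hv.1]⟩ (by linarith)
    rwa [abs_neg, tail_neg (by linarith) hr0 hr (Ioo_subset_Icc_self hv), weight_neg] at this
  have hq0 : 0 < q := by linarith
  have hIcc : Icc v 1 ⊆ Icc (-1) 1 := Icc_subset_Icc_left hv.1.le
  have hi : IntervalIntegrable (fun s => s * weight q s ^ (-r)) volume v 1 :=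
    (intervalIntegrable_tail (by linarith) hr0 hr).mono_set (by
      rw [uIcc_of_le (by norm_num : (-1 : ℝ) ≤ 1), uIcc_of_le hv.2.le]
      exact hIcc)
  have hi2 : IntervalIntegrable (fun s => |s| ^ (q - 2) * s * weight q s ^ (-r)) volume v 1 := by
    refine ((intervalIntegrable_iff_integrableOn_Ioo_of_le (by norm_num)).2
      (integrableOn_mul_weight_rpow_of_continuousOn_Icc (q := q) (by linarith) hr0 hr
      (f := fun s => |s| ^ (q - 2) * s) ?_)).mono_set (a := -1) (b := 1) (by
      rw [uIcc_of_le (by norm_num : (-1 : ℝ) ≤ 1), uIcc_of_le hv.2.le]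
      exact hIcc)
    exact ((continuous_abs.rpow_const fun _ => Or.inr (by linarith)).mul
      continuous_id).continuousOn
  have htail0 : 0 ≤ tail q r v := integral_nonneg hv.2.le fun s hs =>
    mul_nonneg (h0.trans hs.1) (Real.rpow_nonneg (weight_nonneg hq0 (hIcc hs)) _)
  have hexact : ∫ s in v..1, |s| ^ (q - 2) * s * weight q s ^ (-r) =
      weight q v ^ (1 - r) / (q * (1 - r)) := by
    have h := integral_eq_sub_of_hasDerivAt_of_le hv.2.le
      (f := fun s => -(weight q s ^ (1 - r) / (q * (1 - r))))
      (((continuous_weight_rpow hq0 (by linarith : 0 ≤ 1 - r)).div_const _).neg.continuousOn)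
      (fun s hs => ((hasDerivAt_weight_rpow (by linarith) (1 - r)
        ⟨hv.1.trans hs.1, hs.2⟩).div_const (q * (1 - r))).neg) (by
        refine hi2.congr fun s _ => ?_
        rw [show 1 - r - 1 = -r by ring]
        have : 1 - r ≠ 0 := by linarith
        field_simp)
    rw [weight_one, Real.zero_rpow (by linarith), zero_div, neg_zero, zero_sub, neg_neg] at h
    rw [← h]
    refine integral_congr fun s _ => ?_
    rw [show 1 - r - 1 = -r by ring]
    have : 1 - r ≠ 0 := by linarith
    field_simp
  rw [abs_of_nonneg htail0, abs_of_nonneg h0, ← hexact, tail,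
    ← intervalIntegral.integral_const_mul]
  refine integral_mono_on hv.2.le (hi.const_mul _) hi2 fun s hs => ?_
  have hs0 : 0 ≤ s := h0.trans hs.1
  rw [← mul_assoc]
  refine mul_le_mul_of_nonneg_right ?_ (Real.rpow_nonneg (weight_nonneg hq0 (hIcc hs)) _)
  rw [abs_of_nonneg hs0]
  have h1 : v ^ (q - 1) ≤ s ^ (q - 2) := by
    calc v ^ (q - 1) ≤ s ^ (q - 1) := Real.rpow_le_rpow h0 hs.1 (by linarith)
      _ ≤ s ^ (q - 2) := Real.rpow_le_rpow_of_exponent_ge' hs0 hs.2 (by linarith) (by linarith)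
  exact mul_le_mul_of_nonneg_right h1 hs0

/-! ### The perturbation direction and its second variation -/

/-- The unnormalised even perturbation. -/
noncomputable def bump (q r v : ℝ) : ℝ := -v ^ 2 + (q * r - 2) * (weight q v ^ r * tail q r v)

/-- The derivative of `bump`. -/
noncomputable def bumpDeriv (q r v : ℝ) : ℝ :=
  -(q * r) * (v + (q * r - 2) * (|v| ^ (q - 2) * v * tail q r v * weight q v ^ (r - 1)))

/-- The flux `-(1 - |v|^q)^(1-r) bumpDeriv v / (q r)`. -/
noncomputable def flux (q r v : ℝ) : ℝ :=
  v * weight q v ^ (1 - r) + (q * r - 2) * (|v| ^ (q - 2) * v * tail q r v)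

theorem continuous_abs_rpow_mul_self {s : ℝ} (hs : 0 ≤ s) :
    Continuous fun v : ℝ => |v| ^ s * v :=
  (continuous_abs.rpow_const fun _ => Or.inr hs).mul continuous_id

section

variable {q r : ℝ}

theorem bump_neg (hq : 1 ≤ q) (hr0 : 0 ≤ r) (hr : r < 1) {v : ℝ}
    (hv : v ∈ Icc (-1 : ℝ) 1) : bump q r (-v) = bump q r v := by
  rw [bump, bump, tail_neg hq hr0 hr hv, weight_neg, neg_sq]

theorem continuousOn_bump (hq : 1 ≤ q) (hr0 : 0 ≤ r) (hr : r < 1) :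
    ContinuousOn (bump q r) (Icc (-1) 1) :=
  (continuous_pow 2).neg.continuousOn.add (continuousOn_const.mul
    ((continuous_weight_rpow (by linarith) hr0).continuousOn.mul (continuousOn_tail hq hr0 hr)))

theorem hasDerivAt_bump (hq : 1 < q) (hr0 : 0 ≤ r) (hr : r < 1) {v : ℝ}
    (hv : v ∈ Ioo (-1 : ℝ) 1) : HasDerivAt (bump q r) (bumpDeriv q r v) v := by
  have hw := weight_pos (q := q) (by linarith) hv
  have hm : weight q v ^ r * weight q v ^ (-r) = 1 := by
    rw [← Real.rpow_add hw, add_neg_cancel, Real.rpow_zero]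
  convert! (hasDerivAt_pow 2 v).neg.add (((hasDerivAt_weight_rpow hq r hv).mul
    (hasDerivAt_tail hq.le hr0 hr hv)).const_mul (q * r - 2)) using 1
  rw [bumpDeriv]
  push_cast
  linear_combination ((q * r - 2) * v) * hm

theorem continuousOn_bumpDeriv (hq : 2 ≤ q) (hr0 : 0 ≤ r) (hr : r < 1) :
    ContinuousOn (bumpDeriv q r) (Ioo (-1) 1) :=
  continuousOn_const.mul (continuousOn_id.add (continuousOn_const.mul
    (((continuous_abs_rpow_mul_self (by linarith)).continuousOn.mul
      ((continuousOn_tail (by linarith) hr0 hr).mono Ioo_subset_Icc_self)).mul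
      (continuousOn_weight_rpow (by linarith) _))))

theorem exists_abs_bumpDeriv_le (hq : 2 < q) (hr0 : 0 ≤ r) (hr : r < 1) :
    ∃ M > 0, ∀ v ∈ Ioo (-1 : ℝ) 1, |bumpDeriv q r v| ≤ M := by
  refine ⟨|q * r| * (1 + |q * r - 2| * (1 / (q * (1 - r)))) + 1, ?_, fun v hv => ?_⟩
  · have : 0 < 1 - r := by linarith
    positivity
  have hw := weight_pos (q := q) (by linarith) hv
  have hv1 : |v| ≤ 1 := (abs_lt.2 hv).le
  have hkey : |(|v| ^ (q - 2) * v * tail q r v * weight q v ^ (r - 1))| ≤ 1 / (q * (1 - r)) := by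
    have h1 : |(|v| ^ (q - 2) * v)| = |v| ^ (q - 1) := by
      rw [abs_mul, abs_of_nonneg (Real.rpow_nonneg (abs_nonneg v) _)]
      rcases eq_or_ne v 0 with rfl | h
      · simp [Real.zero_rpow (by linarith : q - 1 ≠ 0)]
      · rw [show q - 1 = q - 2 + 1 by ring, Real.rpow_add_one (abs_pos.2 h).ne']
    rw [abs_mul, abs_mul, h1, abs_of_nonneg (Real.rpow_nonneg hw.le (r - 1))]
    calc _ ≤ weight q v ^ (1 - r) / (q * (1 - r)) * weight q v ^ (r - 1) :=
          mul_le_mul_of_nonneg_right (abs_rpow_mul_abs_tail_le hq hr0 hr hv)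
            (Real.rpow_nonneg hw.le _)
      _ = weight q v ^ (1 - r) * weight q v ^ (r - 1) / (q * (1 - r)) := by ring
      _ = _ := by rw [← Real.rpow_add hw]; simp
  rw [bumpDeriv, abs_mul, abs_neg]
  refine (mul_le_mul_of_nonneg_left (b := |v + _|) ((abs_add_le _ _).trans
    (add_le_add hv1 ?_)) (abs_nonneg _)).trans (lt_add_one _).le
  rw [abs_mul]
  exact mul_le_mul_of_nonneg_left hkey (abs_nonneg _)

theorem weight_mul_bumpDeriv (hq : 0 < q) {v : ℝ} (hv : v ∈ Ioo (-1 : ℝ) 1) :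
    weight q v ^ (1 - r) * bumpDeriv q r v = -(q * r) * flux q r v := by
  have hm : weight q v ^ (1 - r) * weight q v ^ (r - 1) = 1 := by
    rw [← Real.rpow_add (weight_pos hq hv)]
    simp
  rw [bumpDeriv, flux]
  linear_combination (-(q * r) * (q * r - 2) * (|v| ^ (q - 2) * v * tail q r v)) * hm

theorem continuousOn_flux (hq : 2 ≤ q) (hr0 : 0 ≤ r) (hr : r < 1) :
    ContinuousOn (flux q r) (Icc (-1) 1) :=
  (continuousOn_id.mul (continuous_weight_rpow (by linarith)
    (by linarith : 0 ≤ 1 - r)).continuousOn).add (continuousOn_const.mul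
    ((continuous_abs_rpow_mul_self (by linarith)).continuousOn.mul
      (continuousOn_tail (by linarith) hr0 hr)))

theorem flux_one (hr : r < 1) : flux q r 1 = 0 := by
  simp [flux, weight_one, tail_one, Real.zero_rpow (by linarith : 1 - r ≠ 0)]

theorem flux_neg_one (hq : 1 ≤ q) (hr0 : 0 ≤ r) (hr : r < 1) : flux q r (-1) = 0 := by
  simp [flux, weight_neg_one, tail_neg_one hq hr0 hr, Real.zero_rpow (by linarith : 1 - r ≠ 0)]

theorem hasDerivAt_flux (hq : 3 < q) (hr0 : 0 ≤ r) (hr : r < 1) {v : ℝ}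
    (hv : v ∈ Ioo (-1 : ℝ) 1) : HasDerivAt (flux q r)
      ((1 + (q - 1) * (|v| ^ (q - 2) * bump q r v)) * weight q v ^ (-r)) v := by
  have hw := weight_pos (q := q) (by linarith) hv
  have hm : weight q v ^ r * weight q v ^ (-r) = 1 := by
    rw [← Real.rpow_add hw, add_neg_cancel, Real.rpow_zero]
  have hm1 : weight q v ^ (1 - r) = (1 - |v| ^ q) * weight q v ^ (-r) := by
    rw [show 1 - r = 1 + -r by ring, Real.rpow_add hw, Real.rpow_one, weight]
  have hsq := abs_rpow_sub_two_mul_sq (by linarith : 2 < q) v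
  convert! ((hasDerivAt_id v).mul
    (hasDerivAt_weight_rpow (q := q) (by linarith) (1 - r) hv)).add
    (((hasDerivAt_abs_rpow_mul_self (by linarith : 1 < q - 2) v).mul
      (hasDerivAt_tail (q := q) (by linarith) hr0 hr hv)).const_mul (q * r - 2)) using 1
  rw [bump, show 1 - r - 1 = -r by ring, hm1]
  simp only [id]
  linear_combination ((q - 1) * (q * r - 2) * |v| ^ (q - 2) * tail q r v) * hm
    + (- weight q v ^ (-r)) * hsq * (q - 1)
    + weight q v ^ (-r) * hsq * (q * (1 - r) + (q * r - 2))

theorem integral_weight_rpow_pos (hq : 1 ≤ q) (hr0 : 0 ≤ r) (hr : r < 1) {f : ℝ → ℝ}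
    (hf : ContinuousOn f (Icc (-1) 1)) (hf0 : ∀ v, 0 ≤ f v) (hfpos : ∀ v, v ≠ 0 → 0 < f v) :
    0 < ∫ v in Ioo (-1 : ℝ) 1, f v * weight q v ^ (-r) := by
  have hi := integrableOn_mul_weight_rpow_of_continuousOn_Icc hq hr0 hr hf
  rw [setIntegral_pos_iff_support_of_nonneg_ae ?_ hi]
  · refine lt_of_lt_of_le (b := volume (Ioo (0 : ℝ) 1)) (by simp) (measure_mono fun v hv => ?_)
    have hv' : v ∈ Ioo (-1 : ℝ) 1 := ⟨by linarith [hv.1], hv.2⟩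
    exact ⟨(mul_pos (hfpos v hv.1.ne')
      (Real.rpow_pos_of_pos (weight_pos (by linarith) hv') _)).ne', hv'⟩
  · refine (ae_restrict_iff' measurableSet_Ioo).2 (.of_forall fun v hv => ?_)
    exact mul_nonneg (hf0 v) (Real.rpow_nonneg (weight_pos (by linarith) hv).le _)

theorem integral_tail (hq : 1 ≤ q) (hr0 : 0 ≤ r) (hr : r < 1) :
    ∫ v in Ioo (-1 : ℝ) 1, tail q r v = ∫ v in Ioo (-1 : ℝ) 1, v ^ 2 * weight q v ^ (-r) := by
  have hi1 : IntegrableOn (tail q r) (Ioo (-1) 1) :=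
    ((continuousOn_tail hq hr0 hr).integrableOn_Icc).mono_set Ioo_subset_Icc_self
  have hi2 := integrableOn_mul_weight_rpow_of_continuousOn_Icc hq hr0 hr
    (f := fun v => v ^ 2) (by fun_prop)
  have h := integral_Ioo_deriv_eq_zero (f := fun v => v * tail q r v)
    (f' := fun v => tail q r v - v ^ 2 * weight q v ^ (-r))
    (continuousOn_id.mul (continuousOn_tail hq hr0 hr)) (fun v hv => by
      convert! (hasDerivAt_id v).mul (hasDerivAt_tail hq hr0 hr hv) using 1
      simp only [id]
      ring) (hi1.sub hi2) (by simp [tail_one, tail_neg_one hq hr0 hr])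
  rw [MeasureTheory.integral_sub hi1 hi2] at h
  linarith

theorem integral_bump (hq : 1 ≤ q) (hr0 : 0 ≤ r) (hr : r < 1) :
    ∫ v in Ioo (-1 : ℝ) 1, bump q r v * weight q v ^ (-r) =
      (q * r - 3) * ∫ v in Ioo (-1 : ℝ) 1, v ^ 2 * weight q v ^ (-r) := by
  have hi1 : IntegrableOn (tail q r) (Ioo (-1) 1) :=
    ((continuousOn_tail hq hr0 hr).integrableOn_Icc).mono_set Ioo_subset_Icc_self
  have hi2 := integrableOn_mul_weight_rpow_of_continuousOn_Icc hq hr0 hr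
    (f := fun v => v ^ 2) (by fun_prop)
  have h : ∫ v in Ioo (-1 : ℝ) 1, bump q r v * weight q v ^ (-r) =
      ∫ v in Ioo (-1 : ℝ) 1, ((q * r - 2) * tail q r v - v ^ 2 * weight q v ^ (-r)) := by
    refine setIntegral_congr_fun measurableSet_Ioo fun v hv => ?_
    have hm : weight q v ^ r * weight q v ^ (-r) = 1 := by
      rw [← Real.rpow_add (weight_pos (by linarith) hv), add_neg_cancel, Real.rpow_zero]
    simp only [bump]
    linear_combination ((q * r - 2) * tail q r v) * hm
  rw [h, MeasureTheory.integral_sub (hi1.const_mul _) hi2, MeasureTheory.integral_const_mul,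
    integral_tail hq hr0 hr]
  ring

theorem second_variation_lt (hq : 3 < q) (hr0 : 0 < r) (hr : r < 1) {m : ℝ} (hm : 0 < m)
    (hmean : ∫ v in Ioo (-1 : ℝ) 1, (bump q r v - m) * weight q v ^ (-r) = 0) :
    ∫ v in Ioo (-1 : ℝ) 1, bumpDeriv q r v ^ 2 * weight q v * weight q v ^ (-r) <
      r * q * (q - 1) * ∫ v in Ioo (-1 : ℝ) 1,
        |v| ^ (q - 2) * (bump q r v - m) ^ 2 * weight q v ^ (-r) := by
  have hq1 : 1 ≤ q := by linarith
  have hbc := continuousOn_bump hq1 hr0.le hr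
  have hac : Continuous fun v : ℝ => |v| ^ (q - 2) :=
    continuous_abs.rpow_const fun _ => Or.inr (by linarith)
  have hI {f : ℝ → ℝ} (hf : ContinuousOn f (Icc (-1) 1)) :=
    integrableOn_mul_weight_rpow_of_continuousOn_Icc hq1 hr0.le hr hf
  have hφc : ContinuousOn (fun v => bump q r v - m) (Icc (-1) 1) := hbc.sub continuousOn_const
  obtain ⟨M, -, hM⟩ := exists_abs_bumpDeriv_le (q := q) (by linarith) hr0.le hr
  have hI1 := hI (f := fun _ => 1) continuousOn_const
  have hIa := hI (f := fun v => |v| ^ (q - 2)) hac.continuousOn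
  have hIφ := hI hφc
  have hIaφ := hI (f := fun v => |v| ^ (q - 2) * (bump q r v - m)) (hac.continuousOn.mul hφc)
  have hIaφ2 := hI (f := fun v => |v| ^ (q - 2) * (bump q r v - m) ^ 2)
    (hac.continuousOn.mul (hφc.pow 2))
  have hId : IntegrableOn (fun v => bumpDeriv q r v ^ 2 * weight q v * weight q v ^ (-r))
      (Ioo (-1) 1) := by
    refine integrableOn_mul_weight_rpow hq1 hr0.le hr (C := M ^ 2 * 1)
      (((continuousOn_bumpDeriv (by linarith) hr0.le hr).pow 2).mul
      (continuous_weight (by linarith)).continuousOn) fun v hv => ?_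
    have hw := weight_pos (q := q) (by linarith) hv
    rw [abs_mul, abs_of_pos hw, abs_pow]
    refine mul_le_mul (pow_le_pow_left₀ (abs_nonneg _) (hM v hv) 2) ?_ hw.le (by positivity)
    have := Real.rpow_nonneg (abs_nonneg v) q
    rw [weight]
    linarith
  have hend : flux q r 1 = flux q r (-1) := by
    rw [flux_one hr, flux_neg_one hq1 hr0.le hr]
  have hflux : (∫ v in Ioo (-1 : ℝ) 1, 1 * weight q v ^ (-r))
      + (q - 1) * (∫ v in Ioo (-1 : ℝ) 1, |v| ^ (q - 2) * (bump q r v - m) * weight q v ^ (-r))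
      + (q - 1) * m * (∫ v in Ioo (-1 : ℝ) 1, |v| ^ (q - 2) * weight q v ^ (-r)) = 0 := by
    rw [← MeasureTheory.integral_const_mul, ← MeasureTheory.integral_const_mul,
      ← MeasureTheory.integral_add hI1 (hIaφ.const_mul _),
      ← MeasureTheory.integral_add (hI1.fun_add (hIaφ.const_mul _)) (hIa.const_mul _)]
    refine integral_Ioo_deriv_eq_zero (continuousOn_flux (by linarith) hr0.le hr)
      (fun v hv => ?_) ((hI1.add (hIaφ.const_mul _)).add (hIa.const_mul _)) hend
    convert! hasDerivAt_flux hq hr0.le hr hv using 1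
    ring
  have henergy : -(1 / (q * r)) * (∫ v in Ioo (-1 : ℝ) 1,
        bumpDeriv q r v ^ 2 * weight q v * weight q v ^ (-r))
      + (∫ v in Ioo (-1 : ℝ) 1, (bump q r v - m) * weight q v ^ (-r))
      + (q - 1) * (∫ v in Ioo (-1 : ℝ) 1, |v| ^ (q - 2) * (bump q r v - m) ^ 2 * weight q v ^ (-r))
      + (q - 1) * m *
        (∫ v in Ioo (-1 : ℝ) 1, |v| ^ (q - 2) * (bump q r v - m) * weight q v ^ (-r)) = 0 := by
    rw [← MeasureTheory.integral_const_mul, ← MeasureTheory.integral_const_mul,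
      ← MeasureTheory.integral_const_mul, ← MeasureTheory.integral_add (hId.const_mul _) hIφ,
      ← MeasureTheory.integral_add ((hId.const_mul _).fun_add hIφ) (hIaφ2.const_mul _),
      ← MeasureTheory.integral_add (((hId.const_mul _).fun_add hIφ).fun_add (hIaφ2.const_mul _))
        (hIaφ.const_mul _)]
    refine integral_Ioo_deriv_eq_zero (f := fun v => (bump q r v - m) * flux q r v)
      (hφc.mul (continuousOn_flux (by linarith) hr0.le hr))
      (fun v hv => ?_)
      ((((hId.const_mul _).add hIφ).add (hIaφ2.const_mul _)).add (hIaφ.const_mul _)) ?_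
    · convert! ((hasDerivAt_bump (q := q) (by linarith) hr0.le hr hv).sub_const m).mul
        (hasDerivAt_flux hq hr0.le hr hv) using 1
      have h1 := weight_mul_bumpDeriv (r := r) (by linarith : 0 < q) hv
      have h2 : weight q v ^ (1 - r) = weight q v * weight q v ^ (-r) := by
        rw [show 1 - r = 1 + -r by ring, Real.rpow_add (weight_pos (by linarith) hv),
          Real.rpow_one]
      have h3 : flux q r v = -(1 / (q * r)) *
          (weight q v * weight q v ^ (-r) * bumpDeriv q r v) := by
        rw [← h2, h1]
        field_simp
      rw [h3]
      ring
    · simp only [flux_one hr, flux_neg_one hq1 hr0.le hr, mul_zero]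
  have hT : 0 < ∫ v in Ioo (-1 : ℝ) 1, 1 * weight q v ^ (-r) :=
    integral_weight_rpow_pos hq1 hr0.le hr (f := fun _ => 1) continuousOn_const
      (fun _ => zero_le_one) fun _ _ => zero_lt_one
  have ha : 0 < ∫ v in Ioo (-1 : ℝ) 1, |v| ^ (q - 2) * weight q v ^ (-r) :=
    integral_weight_rpow_pos hq1 hr0.le hr hac.continuousOn
      (fun v => Real.rpow_nonneg (abs_nonneg v) _)
      fun v hv => Real.rpow_pos_of_pos (abs_pos.2 hv) _
  rw [hmean] at henergy
  set T := ∫ v in Ioo (-1 : ℝ) 1, 1 * weight q v ^ (-r)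
  set a := ∫ v in Ioo (-1 : ℝ) 1, |v| ^ (q - 2) * weight q v ^ (-r)
  set D := ∫ v in Ioo (-1 : ℝ) 1, bumpDeriv q r v ^ 2 * weight q v * weight q v ^ (-r)
  set B := ∫ v in Ioo (-1 : ℝ) 1, |v| ^ (q - 2) * (bump q r v - m) ^ 2 * weight q v ^ (-r)
  set c := ∫ v in Ioo (-1 : ℝ) 1, |v| ^ (q - 2) * (bump q r v - m) * weight q v ^ (-r)
  have hq' : 0 < q - 1 := by linarith
  have hneg : (q - 1) * m * c < 0 := by
    have h1 : (q - 1) * m * c = -(m * T + (q - 1) * m ^ 2 * a) := by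
      linear_combination m * hflux
    rw [h1]
    have : 0 < m * T + (q - 1) * m ^ 2 * a := by positivity
    linarith
  have hqr : 0 < q * r := by positivity
  have hD : D = q * r * ((q - 1) * B + (q - 1) * m * c) := by
    field_simp at henergy
    linear_combination -henergy
  rw [hD]
  have := mul_neg_of_pos_of_neg hqr hneg
  nlinarith

end

/-! ### Comparison of the energies along the perturbation -/

section

variable {q r : ℝ}

theorem integral_weight_mul_weight_rpow (hq2 : 2 < q) (hr0 : 0 ≤ r) (hr : r < 1) :
    ∫ v in Ioo (-1 : ℝ) 1, weight q v * weight q v ^ (-r) =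
      q * (1 - r) * ∫ v in Ioo (-1 : ℝ) 1, |v| ^ q * weight q v ^ (-r) := by
  have hq : 1 < q := by linarith
  have hac : Continuous fun v : ℝ => |v| ^ q :=
    continuous_abs.rpow_const fun _ => Or.inr (by linarith)
  have hi1 := integrableOn_mul_weight_rpow_of_continuousOn_Icc hq.le hr0 hr
    (continuous_weight (q := q) (by linarith)).continuousOn
  have hi2 := integrableOn_mul_weight_rpow_of_continuousOn_Icc hq.le hr0 hr hac.continuousOn
  have h := integral_Ioo_deriv_eq_zero (f := fun v => v * weight q v ^ (1 - r))
    (f' := fun v => weight q v * weight q v ^ (-r) -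
      q * (1 - r) * (|v| ^ q * weight q v ^ (-r)))
    (continuousOn_id.mul (continuous_weight_rpow (by linarith) (by linarith)).continuousOn)
    (fun v hv => by
      convert! (hasDerivAt_id v).mul (hasDerivAt_weight_rpow hq (1 - r) hv) using 1
      have hw := weight_pos (q := q) (by linarith) hv
      have h1 : weight q v ^ (1 - r) = weight q v * weight q v ^ (-r) := by
        rw [sub_eq_add_neg, Real.rpow_add hw, Real.rpow_one]
      have h2 := abs_rpow_sub_two_mul_sq hq2 v
      rw [show 1 - r - 1 = -r by ring, h1]
      simp only [id]
      linear_combination (q * (1 - r) * weight q v ^ (-r)) * h2)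
    (hi1.sub (hi2.const_mul _)) (by simp [weight_one, weight_neg_one, Real.zero_rpow,
      (by linarith : 1 - r ≠ 0)])
  rw [MeasureTheory.integral_sub hi1 (hi2.const_mul _), MeasureTheory.integral_const_mul] at h
  linarith

theorem integral_weight_rpow_eq (hq2 : 2 < q) (hr0 : 0 ≤ r) (hr : r < 1) :
    ∫ v in Ioo (-1 : ℝ) 1, weight q v ^ (-r) =
      (1 + q * (1 - r)) * ∫ v in Ioo (-1 : ℝ) 1, |v| ^ q * weight q v ^ (-r) := by
  have hq : 1 < q := by linarith
  have hac : Continuous fun v : ℝ => |v| ^ q :=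
    continuous_abs.rpow_const fun _ => Or.inr (by linarith)
  have hi1 := integrableOn_mul_weight_rpow_of_continuousOn_Icc hq.le hr0 hr
    (continuous_weight (q := q) (by linarith)).continuousOn
  have hi2 := integrableOn_mul_weight_rpow_of_continuousOn_Icc hq.le hr0 hr hac.continuousOn
  have h : ∫ v in Ioo (-1 : ℝ) 1, weight q v ^ (-r) = ∫ v in Ioo (-1 : ℝ) 1,
      (weight q v * weight q v ^ (-r) + |v| ^ q * weight q v ^ (-r)) :=
    integral_congr_ae (.of_forall fun v => by simp only [weight]; ring)
  rw [h, MeasureTheory.integral_add hi1 hi2, integral_weight_mul_weight_rpow hq2 hr0 hr]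
  ring

end

theorem schmidtC_mul_integral_weight_rpow {p q : ℝ} (hp : 1 < p) (hq : 0 < q) :
    schmidtC p q * (∫ v in Ioo (-1 : ℝ) 1, weight q v ^ (-(1 / p))) *
      ((1 - 1 / p) / (1 / q + (1 - 1 / p))) ^ (1 / p) =
      (1 / q / (1 / q + (1 - 1 / p))) ^ (1 / q) := by
  have hr : 1 / p < 1 := by rw [div_lt_one] <;> linarith
  have hT := integral_one_sub_abs_rpow_rpow hq hr
  have hp' : 1 / (p / (p - 1)) = 1 - 1 / p := by
    have : p ≠ 0 := by linarith
    have : p - 1 ≠ 0 := by linarith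
    field_simp
  unfold weight
  rw [hT, schmidtC, hp', frakF, frakF, frakF]
  set s := 1 - 1 / p with hs
  set κ := 1 / q with hκ
  have hs0 : 0 < s := by linarith
  have hκ0 : 0 < κ := by positivity
  have hσ0 : 0 < κ + s := by linarith
  rw [Real.Gamma_add_one hs0.ne', Real.Gamma_add_one hκ0.ne', Real.Gamma_add_one hσ0.ne',
    show 1 / p = 1 - s by ring, Real.div_rpow hs0.le hσ0.le, Real.div_rpow hκ0.le hσ0.le,
    Real.rpow_sub hs0, Real.rpow_one, Real.rpow_sub hσ0, Real.rpow_one, Real.rpow_add hσ0]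
  have h1 := Real.Gamma_pos_of_pos hs0
  have h2 := Real.Gamma_pos_of_pos hκ0
  have h3 := Real.Gamma_pos_of_pos hσ0
  have h4 := Real.rpow_pos_of_pos hs0 s
  have h5 := Real.rpow_pos_of_pos hκ0 κ
  have h6 := Real.rpow_pos_of_pos hσ0 s
  have h7 := Real.rpow_pos_of_pos hσ0 κ
  generalize s ^ s = a at *
  generalize κ ^ κ = b at *
  generalize (κ + s) ^ s = c at *
  generalize (κ + s) ^ κ = d at *
  generalize κ + s = e at *
  field_simp
  rw [hs, sub_sub_cancel]

section

variable {q r : ℝ} {φ d : ℝ → ℝ}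

theorem integral_Ioo_eq_zero_of_odd_on {f : ℝ → ℝ} (hf : ∀ v ∈ Ioo (-1 : ℝ) 1, f (-v) = -f v) :
    ∫ v in Ioo (-1 : ℝ) 1, f v = 0 := by
  have h := integral_Ioo_comp_neg f
  rw [setIntegral_congr_fun measurableSet_Ioo hf, MeasureTheory.integral_neg] at h
  linarith

theorem bumpDeriv_neg (hq : 1 ≤ q) (hr0 : 0 ≤ r) (hr : r < 1) {v : ℝ}
    (hv : v ∈ Icc (-1 : ℝ) 1) : bumpDeriv q r (-v) = -bumpDeriv q r v := by
  rw [bumpDeriv, bumpDeriv, tail_neg hq hr0 hr hv, weight_neg, abs_neg]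
  ring

theorem le_integral_abs_add_mul_rpow (hq : 3 < q) (hr0 : 0 ≤ r) (hr : r < 1)
    (hφ : ContinuousOn φ (Icc (-1) 1)) (hφe : ∀ v ∈ Ioo (-1 : ℝ) 1, φ (-v) = φ v) (ε : ℝ) :
    (∫ v in Ioo (-1 : ℝ) 1, |v| ^ q * weight q v ^ (-r)) + q * (q - 1) / 2 * ε ^ 2 *
        (∫ v in Ioo (-1 : ℝ) 1, |v| ^ (q - 2) * φ v ^ 2 * weight q v ^ (-r)) ≤
      ∫ v in Ioo (-1 : ℝ) 1, |v + ε * φ v| ^ q * weight q v ^ (-r) := by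
  have hq1 : 1 ≤ q := by linarith
  have hI {f : ℝ → ℝ} (hf : ContinuousOn f (Icc (-1) 1)) :=
    integrableOn_mul_weight_rpow_of_continuousOn_Icc hq1 hr0 hr hf
  have hac {s : ℝ} (hs : 0 ≤ s) : Continuous fun v : ℝ => |v| ^ s :=
    continuous_abs.rpow_const fun _ => Or.inr hs
  have hi1 := hI (hac (s := q) (by linarith)).continuousOn
  have hi2 := hI (f := fun v => |v| ^ (q - 2) * φ v ^ 2)
    ((hac (by linarith)).continuousOn.mul (hφ.pow 2))
  have hεφ : ContinuousOn (fun v => ε * φ v) (Icc (-1) 1) := continuousOn_const.mul hφ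
  have hi3 := hI (f := fun v => |v + ε * φ v| ^ q)
    ((hac (by linarith)).comp_continuousOn (continuousOn_id.add hεφ))
  have hi4 := hI (f := fun v => |v - ε * φ v| ^ q)
    ((hac (by linarith)).comp_continuousOn (continuousOn_id.sub hεφ))
  have hsymm : ∫ v in Ioo (-1 : ℝ) 1, |v - ε * φ v| ^ q * weight q v ^ (-r) =
      ∫ v in Ioo (-1 : ℝ) 1, |v + ε * φ v| ^ q * weight q v ^ (-r) := by
    rw [← integral_Ioo_comp_neg]
    refine setIntegral_congr_fun measurableSet_Ioo fun v hv => ?_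
    simp only [hφe v hv, weight_neg, ← neg_add', abs_neg]
  have hle := setIntegral_mono_on ((hi1.const_mul 2).add (hi2.const_mul (q * (q - 1) * ε ^ 2)))
    (hi3.add hi4) measurableSet_Ioo fun v hv => by
      have h := mul_le_mul_of_nonneg_right (two_mul_abs_rpow_add_le hq v (ε * φ v))
        (Real.rpow_nonneg (weight_pos (by linarith) hv).le (-r) : 0 ≤ weight q v ^ (-r))
      simp only [Pi.add_apply]
      linarith
  rw [integral_add' (hi1.const_mul 2) (hi2.const_mul _), integral_add' hi3 hi4, hsymm,
    MeasureTheory.integral_const_mul, MeasureTheory.integral_const_mul] at hle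
  linarith

theorem eventually_integral_abs_one_add_mul_rpow_le {p c M : ℝ} (hp : 1 < p)
    (hc : p * (p - 1) / 2 < c) (hq : 1 ≤ q) (hr0 : 0 ≤ r) (hr : r < 1)
    (hd : ContinuousOn d (Ioo (-1) 1)) (hM : 0 < M) (hdM : ∀ v ∈ Ioo (-1 : ℝ) 1, |d v| ≤ M)
    (hdo : ∀ v ∈ Ioo (-1 : ℝ) 1, d (-v) = -d v) :
    ∀ᶠ ε in 𝓝[>] 0, ∫ v in Ioo (-1 : ℝ) 1, |1 + ε * d v| ^ p * weight q v * weight q v ^ (-r) ≤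
      (∫ v in Ioo (-1 : ℝ) 1, weight q v * weight q v ^ (-r)) + c * ε ^ 2 *
        ∫ v in Ioo (-1 : ℝ) 1, d v ^ 2 * weight q v * weight q v ^ (-r) := by
  obtain ⟨η, hη, hη1, hηle⟩ := exists_one_add_rpow_le hp hc
  filter_upwards [Ioo_mem_nhdsGT (div_pos hη hM)] with ε hε
  have hsmall {v : ℝ} (hv : v ∈ Ioo (-1 : ℝ) 1) : |ε * d v| ≤ η := by
    rw [abs_mul, abs_of_pos hε.1]
    calc ε * |d v| ≤ η / M * M := mul_le_mul hε.2.le (hdM v hv) (abs_nonneg _) (by positivity)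
      _ = η := by field_simp
  have hw : ContinuousOn (weight q) (Ioo (-1) 1) :=
    (continuous_weight (by linarith)).continuousOn
  have hw1 {v : ℝ} (hv : v ∈ Ioo (-1 : ℝ) 1) : |weight q v| ≤ 1 := by
    rw [abs_of_pos (weight_pos (by linarith) hv)]
    exact sub_le_self _ (Real.rpow_nonneg (abs_nonneg v) q)
  have hI {f : ℝ → ℝ} (hf : ContinuousOn f (Ioo (-1) 1)) {C : ℝ}
      (hC : ∀ v ∈ Ioo (-1 : ℝ) 1, |f v| ≤ C) :
      IntegrableOn (fun v => f v * weight q v * weight q v ^ (-r)) (Ioo (-1) 1) :=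
    integrableOn_mul_weight_rpow hq hr0 hr (f := fun v => f v * weight q v) (hf.mul hw)
      (C := C * 1) fun v hv => by
        rw [abs_mul]
        exact mul_le_mul (hC v hv) (hw1 hv) (abs_nonneg _) ((abs_nonneg _).trans (hC v hv))
  have hi1 := integrableOn_mul_weight_rpow hq hr0 hr hw fun v hv => hw1 hv
  have hi2 := hI hd hdM
  have hi3 := hI (f := fun v => d v ^ 2) (hd.pow 2) (C := M ^ 2) fun v hv => by
    rw [abs_pow]
    exact pow_le_pow_left₀ (abs_nonneg _) (hdM v hv) 2
  have hi4 := hI (f := fun v => |1 + ε * d v| ^ p)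
    ((continuousOn_const.add (continuousOn_const.mul hd)).abs.rpow_const
      fun v _ => Or.inr (by linarith)) (C := 2 ^ p) fun v hv => by
    rw [abs_of_nonneg (Real.rpow_nonneg (abs_nonneg _) _)]
    refine Real.rpow_le_rpow (abs_nonneg _) ((abs_add_le _ _).trans ?_) (by linarith)
    rw [abs_one]
    linarith [hsmall hv]
  have hzero : ∫ v in Ioo (-1 : ℝ) 1, d v * weight q v * weight q v ^ (-r) = 0 :=
    integral_Ioo_eq_zero_of_odd_on fun v hv => by
      rw [hdo v hv, weight_neg]
      ring
  have hle := setIntegral_mono_on hi4 ((hi1.add (hi2.const_mul (p * ε))).add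
    (hi3.const_mul (c * ε ^ 2))) measurableSet_Ioo fun v hv => by
      have hs := hsmall hv
      have h := hηle _ hs
      have hww : 0 ≤ weight q v * weight q v ^ (-r) :=
        mul_nonneg (weight_pos (by linarith) hv).le
          (Real.rpow_nonneg (weight_pos (by linarith) hv).le (-r))
      rw [abs_of_pos (by linarith [neg_le_of_abs_le hs])]
      have := mul_le_mul_of_nonneg_right h hww
      simp only [Pi.add_apply]
      linarith
  rwa [integral_add' (hi1.add (hi2.const_mul _)) (hi3.const_mul _), integral_add' hi1
    (hi2.const_mul _), MeasureTheory.integral_const_mul, MeasureTheory.integral_const_mul, hzero,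
    mul_zero, add_zero] at hle

theorem continuousOn_weight_rpow_mul (hq : 0 < q) (hr0 : 0 < r) {g : ℝ → ℝ} {C : ℝ}
    (hg : ContinuousOn g (Ioo (-1) 1)) (hC : ∀ v ∈ Ioo (-1 : ℝ) 1, |g v| ≤ C) :
    ContinuousOn (fun v => weight q v ^ r * g v) (Icc (-1) 1) := by
  have hwc := continuous_weight_rpow hq hr0.le
  have hend {a : ℝ} (ha : weight q a = 0) :
      ContinuousWithinAt (fun v => weight q v ^ r * g v) (Icc (-1) 1) a := by
    have h0 : weight q a ^ r = 0 := by rw [ha, Real.zero_rpow hr0.ne']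
    have hval {v : ℝ} (hv : v ∈ Icc (-1 : ℝ) 1) :
        ‖weight q v ^ r * g v‖ ≤ weight q v ^ r * C := by
      rw [norm_mul, Real.norm_of_nonneg (Real.rpow_nonneg (weight_nonneg hq hv) r)]
      by_cases hv' : v ∈ Ioo (-1 : ℝ) 1
      · exact mul_le_mul_of_nonneg_left (hC v hv') (Real.rpow_nonneg (weight_nonneg hq hv) r)
      · have hz : weight q v = 0 := by
          rcases hv.1.eq_or_lt with h | h
          · rw [← h, weight_neg_one]
          · rw [hv.2.antisymm (not_lt.1 fun h' => hv' ⟨h, h'⟩), weight_one]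
        simp [hz, Real.zero_rpow hr0.ne']
    rw [ContinuousWithinAt, h0, zero_mul]
    refine squeeze_zero_norm' (eventually_mem_nhdsWithin.mono fun v hv => hval hv) ?_
    have := ((hwc.mul_const C).tendsto a).mono_left (nhdsWithin_le_nhds (s := Icc (-1 : ℝ) 1))
    rwa [h0, zero_mul] at this
  intro v hv
  by_cases hv' : v ∈ Ioo (-1 : ℝ) 1
  · exact (hwc.continuousAt.mul
      (hg.continuousAt (isOpen_Ioo.mem_nhds hv'))).continuousWithinAt
  · refine hend ?_
    rcases hv.1.eq_or_lt with h | h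
    · rw [← h, weight_neg_one]
    · rw [hv.2.antisymm (not_lt.1 fun h' => hv' ⟨h, h'⟩), weight_one]

theorem exists_perturbed_function {p M : ℝ} (hp : 1 < p) (hq : 1 ≤ q)
    (hφ : ContinuousOn φ (Icc (-1) 1)) (hφd : ∀ v ∈ Ioo (-1 : ℝ) 1, HasDerivAt φ (d v) v)
    (hd : ContinuousOn d (Ioo (-1) 1)) (hdM : ∀ v ∈ Ioo (-1 : ℝ) 1, |d v| ≤ M)
    (hmean : ∫ v in Ioo (-1 : ℝ) 1, φ v * weight q v ^ (-(1 / p)) = 0) {ε : ℝ} (hε : 0 ≤ ε)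
    {T : ℝ} (hT : T = ∫ v in Ioo (-1 : ℝ) 1, weight q v ^ (-(1 / p))) (hT0 : 0 < T) :
    ∃ u u' : ℝ → ℝ,
      (∀ x ∈ Icc (0 : ℝ) 1, HasDerivWithinAt u (u' x) (Icc (0 : ℝ) 1) x) ∧
      ContinuousOn u' (Icc (0 : ℝ) 1) ∧ (∫ x in (0 : ℝ)..1, u x) = 0 ∧
      (∫ x in (0 : ℝ)..1, |u x| ^ q) =
        (∫ v in Ioo (-1 : ℝ) 1, |v + ε * φ v| ^ q * weight q v ^ (-(1 / p))) / T ∧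
      (∫ x in (0 : ℝ)..1, |u' x| ^ p) = T ^ p *
        ((∫ v in Ioo (-1 : ℝ) 1, |1 + ε * d v| ^ p * weight q v * weight q v ^ (-(1 / p))) /
          T) := by
  have hr0 : 0 < 1 / p := by positivity
  have hr : 1 / p < 1 := by rw [div_lt_one] <;> linarith
  have hq0 : 0 < q := by linarith
  have hm {v : ℝ} (hv : v ∈ Ioo (-1 : ℝ) 1) :
      weight q v ^ (1 / p) * weight q v ^ (-(1 / p)) = 1 := by
    rw [← Real.rpow_add (weight_pos hq0 hv), add_neg_cancel, Real.rpow_zero]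
  have hdc : ContinuousOn (fun v => 1 + ε * d v) (Ioo (-1) 1) :=
    continuousOn_const.add (continuousOn_const.mul hd)
  have hdb : ∀ v ∈ Ioo (-1 : ℝ) 1, |1 + ε * d v| ≤ 1 + ε * M := fun v hv => by
    refine (abs_add_le _ _).trans ?_
    rw [abs_one, abs_mul, abs_of_nonneg hε]
    have := mul_le_mul_of_nonneg_left (hdM v hv) hε
    linarith
  obtain ⟨u, u', hu, hu', hH, hK⟩ := exists_transport (ρ := fun v => weight q v ^ (-(1 / p)) / T)
    (V := fun v => v + ε * φ v) (K := fun v => T * (weight q v ^ (1 / p) * (1 + ε * d v)))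
    ((continuousOn_weight_rpow hq0 _).div_const T)
    (fun v hv => div_pos (Real.rpow_pos_of_pos (weight_pos hq0 hv) _) hT0)
    ((integrableOn_weight_rpow hq hr0.le hr).div_const T)
    (by rw [MeasureTheory.integral_div, ← hT, div_self hT0.ne'])
    (continuousOn_id.add (continuousOn_const.mul hφ))
    (continuousOn_const.mul (continuousOn_weight_rpow_mul hq0 hr0 hdc hdb))
    (fun v hv => by
      convert! (hasDerivAt_id v).add ((hφd v hv).const_mul ε) using 1
      field_simp
      linear_combination (1 + ε * d v) * hm hv)
  refine ⟨u, u', hu, hu', ?_, ?_, ?_⟩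
  · have hi := integrableOn_mul_weight_rpow_of_continuousOn_Icc hq hr0.le hr hφ
    have hi1 := integrableOn_mul_weight_rpow_of_continuousOn_Icc hq hr0.le hr continuousOn_id
    have hodd : ∫ v in Ioo (-1 : ℝ) 1, id v * weight q v ^ (-(1 / p)) = 0 :=
      integral_Ioo_eq_zero_of_odd fun v => by simp [weight_neg]
    rw [hH fun y => y]
    simp only [← mul_div_assoc]
    rw [MeasureTheory.integral_div, div_eq_zero_iff]
    left
    have h := integral_add' hi1 (hi.const_mul ε)
    rw [MeasureTheory.integral_const_mul, hmean, hodd, mul_zero, add_zero] at h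
    rw [← h]
    refine integral_congr_ae (.of_forall fun v => ?_)
    simp only [Pi.add_apply, id]
    ring
  · rw [hH fun y => |y| ^ q]
    simp only [← mul_div_assoc]
    rw [MeasureTheory.integral_div]
  · rw [hK fun y => |y| ^ p, ← MeasureTheory.integral_div, ← MeasureTheory.integral_const_mul]
    refine setIntegral_congr_fun measurableSet_Ioo fun v hv => ?_
    have hw := weight_pos hq0 hv
    have hwr := Real.rpow_pos_of_pos hw (1 / p)
    rw [abs_mul, abs_mul, abs_of_pos hT0, abs_of_pos hwr,
      Real.mul_rpow hT0.le (by positivity), Real.mul_rpow hwr.le (abs_nonneg _),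
      ← Real.rpow_mul hw.le, one_div_mul_cancel (by linarith), Real.rpow_one]
    ring

end

theorem schmidtC_nonneg {p q : ℝ} (hp : 1 < p) (hq : 0 < q) : 0 ≤ schmidtC p q := by
  have h (s : ℝ) (hs : 0 ≤ s) : 0 ≤ frakF s :=
    div_nonneg (Real.Gamma_pos_of_pos (by linarith)).le (Real.rpow_nonneg hs s)
  have hp' : 0 ≤ 1 / (p / (p - 1)) := by
    have : 0 < p - 1 := by linarith
    positivity
  have hq' : 0 ≤ 1 / q := by positivity
  exact div_nonneg (h _ (by positivity)) (mul_nonneg (mul_nonneg zero_le_two (h _ hq')) (h _ hp'))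

theorem mul_rpow_lt_rpow_of_perturbation {p q C T A b a' b' s A' B' : ℝ} (hp : 0 < p) (hq : 0 < q)
    (hC : 0 ≤ C) (hT : 0 < T) (hA : 0 < A) (hb : 0 < b) (hs : 0 ≤ s) (ha' : 0 ≤ a') (hb' : 0 ≤ b')
    (hCT : C * T * (A / T) ^ (1 / p) = (b / T) ^ (1 / q)) (hA' : 0 ≤ A') (hAA : A' ≤ A + a' * s)
    (hBB : b + b' * s ≤ B') (hlt : (1 + a' / A * s) ^ (1 / p) < (1 + b' / b * s) ^ (1 / q)) :
    C * (T ^ p * (A' / T)) ^ (1 / p) < (B' / T) ^ (1 / q) := by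
  calc C * (T ^ p * (A' / T)) ^ (1 / p) ≤ C * (T ^ p * ((A + a' * s) / T)) ^ (1 / p) := by gcongr
    _ = C * T * (A / T) ^ (1 / p) * (1 + a' / A * s) ^ (1 / p) := by
      rw [show (A + a' * s) / T = A / T * (1 + a' / A * s) by field_simp,
        Real.mul_rpow (by positivity) (by positivity), Real.mul_rpow (by positivity)
        (by positivity), ← Real.rpow_mul hT.le, mul_one_div_cancel hp.ne', Real.rpow_one]
      ring
    _ < (b / T) ^ (1 / q) * (1 + b' / b * s) ^ (1 / q) := by
      rw [hCT]
      gcongr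
    _ = ((b + b' * s) / T) ^ (1 / q) := by
      rw [← Real.mul_rpow (by positivity) (by positivity)]
      congr 1
      field_simp
    _ ≤ (B' / T) ^ (1 / q) := by gcongr

theorem exists_gt_mul_lt {c₀ x y : ℝ} (h : c₀ * x < y) : ∃ c, c₀ < c ∧ c * x < y := by
  have hcont : Tendsto (fun c => c * x) (𝓝[>] c₀) (𝓝 (c₀ * x)) :=
    (Continuous.tendsto (by fun_prop) _).mono_left nhdsWithin_le_nhds
  exact (eventually_mem_nhdsWithin.and (hcont.eventually_lt_const h)).exists

set_option maxHeartbeats 800000 in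
theorem exists_schmidtC_mul_lt {p q : ℝ} (hp : 1 < p) (hqp : 3 * p < q) :
    ∃ u u' : ℝ → ℝ,
      (∀ x ∈ Icc (0 : ℝ) 1, HasDerivWithinAt u (u' x) (Icc (0 : ℝ) 1) x) ∧
      ContinuousOn u' (Icc (0 : ℝ) 1) ∧ (∫ x in (0 : ℝ)..1, u x) = 0 ∧
      schmidtC p q * (∫ x in (0 : ℝ)..1, |u' x| ^ p) ^ (1 / p) <
        (∫ x in (0 : ℝ)..1, |u x| ^ q) ^ (1 / q) := by
  have hp0 : 0 < p := by linarith
  have hq3 : 3 < q := by linarith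
  have hq0 : 0 < q := by linarith
  have hq1 : 1 ≤ q := by linarith
  have hschmidt := schmidtC_mul_integral_weight_rpow hp hq0
  have hC := schmidtC_nonneg hp hq0
  have hr0 : 0 < 1 / p := by positivity
  have hr1 : 1 / p < 1 := by rw [div_lt_one] <;> linarith
  have hs0 : 0 < 1 - 1 / p := by linarith
  have hac : Continuous fun v : ℝ => |v| ^ q :=
    continuous_abs.rpow_const fun _ => Or.inr hq0.le
  have hb0 := integral_weight_rpow_pos (q := q) (r := 1 / p) hq1 hr0.le hr1 hac.continuousOn
    (fun v => Real.rpow_nonneg (abs_nonneg v) q) fun v hv => Real.rpow_pos_of_pos (abs_pos.2 hv) q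
  have hsq := integral_weight_rpow_pos (q := q) (r := 1 / p) hq1 hr0.le hr1
    (continuous_pow 2).continuousOn (fun v => sq_nonneg v) fun v hv => by positivity
  have hTb := integral_weight_rpow_eq (q := q) (by linarith) hr0.le hr1
  have hAb := integral_weight_mul_weight_rpow (q := q) (by linarith) hr0.le hr1
  have hbump := integral_bump (q := q) hq1 hr0.le hr1
  set T := ∫ v in Ioo (-1 : ℝ) 1, weight q v ^ (-(1 / p)) with hT
  set b := ∫ v in Ioo (-1 : ℝ) 1, |v| ^ q * weight q v ^ (-(1 / p))
  set A := ∫ v in Ioo (-1 : ℝ) 1, weight q v * weight q v ^ (-(1 / p))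
  have hT0 : 0 < T := by rw [hTb]; positivity
  have hA0 : 0 < A := by rw [hAb]; positivity
  have hqr : 0 < q * (1 / p) - 3 := by
    rw [mul_one_div, sub_pos, lt_div_iff₀ hp0]
    exact hqp
  set m := (∫ v in Ioo (-1 : ℝ) 1, bump q (1 / p) v * weight q v ^ (-(1 / p))) / T with hm
  have hm0 : 0 < m := by
    rw [hm, hbump]
    exact div_pos (mul_pos hqr hsq) hT0
  have hbc := continuousOn_bump (q := q) hq1 hr0.le hr1
  have hφc : ContinuousOn (fun v => bump q (1 / p) v - m) (Icc (-1) 1) :=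
    hbc.sub continuousOn_const
  have hmean : ∫ v in Ioo (-1 : ℝ) 1, (bump q (1 / p) v - m) * weight q v ^ (-(1 / p)) = 0 := by
    simp only [sub_mul]
    rw [MeasureTheory.integral_sub
      (integrableOn_mul_weight_rpow_of_continuousOn_Icc hq1 hr0.le hr1 hbc)
      ((integrableOn_weight_rpow hq1 hr0.le hr1).const_mul m), MeasureTheory.integral_const_mul,
      ← hT, hm, div_mul_cancel₀ _ hT0.ne', sub_self]
  have hsec := second_variation_lt hq3 hr0 hr1 hm0 hmean
  have hα0 : 0 ≤ ∫ v in Ioo (-1 : ℝ) 1,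
      bumpDeriv q (1 / p) v ^ 2 * weight q v * weight q v ^ (-(1 / p)) :=
    setIntegral_nonneg measurableSet_Ioo fun v hv => by
      have := weight_pos hq0 hv
      positivity
  have hlower := le_integral_abs_add_mul_rpow hq3 hr0.le hr1 hφc fun v hv => by
    rw [bump_neg hq1 hr0.le hr1 (Ioo_subset_Icc_self hv)]
  set α := ∫ v in Ioo (-1 : ℝ) 1,
    bumpDeriv q (1 / p) v ^ 2 * weight q v * weight q v ^ (-(1 / p)) with hα
  set β := ∫ v in Ioo (-1 : ℝ) 1,
    |v| ^ (q - 2) * (bump q (1 / p) v - m) ^ 2 * weight q v ^ (-(1 / p))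
  obtain ⟨c, hc, hcα⟩ : ∃ c, p * (p - 1) / 2 < c ∧
      c * (α * (1 / p)) < q * (q - 1) * (1 - 1 / p) * β / 2 := by
    refine exists_gt_mul_lt ?_
    have h := mul_lt_mul_of_pos_left hsec (show 0 < (p - 1) / 2 by linarith)
    calc _ = (p - 1) / 2 * α := by field_simp
      _ < _ := h
      _ = _ := by field_simp
  obtain ⟨M, hM0, hM⟩ := exists_abs_bumpDeriv_le (q := q) (by linarith) hr0.le hr1
  have hdc := continuousOn_bumpDeriv (q := q) (by linarith) hr0.le hr1
  have hupper := eventually_integral_abs_one_add_mul_rpow_le hp hc hq1 hr0.le hr1 hdc hM0 hM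
    fun v hv => bumpDeriv_neg hq1 hr0.le hr1 (Ioo_subset_Icc_self hv)
  have hcmp := eventually_one_add_mul_rpow_lt (a := c * α / A) (α := 1 / p)
    (b := q * (q - 1) / 2 * β / b) (β := 1 / q) (by
      rw [hAb]
      calc c * α / (q * (1 - 1 / p) * b) * (1 / p) =
            c * (α * (1 / p)) / (q * (1 - 1 / p) * b) := by ring
        _ < q * (q - 1) * (1 - 1 / p) * β / 2 / (q * (1 - 1 / p) * b) := by gcongr
        _ = _ := by
          generalize 1 - 1 / p = t at *
          field_simp)
  have hsqt : Tendsto (fun ε : ℝ => ε ^ 2) (𝓝[>] 0) (𝓝[>] 0) :=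
    tendsto_nhdsWithin_of_tendsto_nhds_of_eventually_within _
      (((continuous_pow 2).tendsto' 0 0 (by norm_num)).mono_left nhdsWithin_le_nhds)
      (eventually_mem_nhdsWithin.mono fun ε hε => pow_pos (mem_Ioi.1 hε) 2)
  obtain ⟨ε, hε, hup, hlt⟩ :=
    (eventually_mem_nhdsWithin.and (hupper.and (hsqt.eventually hcmp))).exists
  have hε : 0 < ε := hε
  obtain ⟨u, u', hu, hu', hu0, huq, hup'⟩ := exists_perturbed_function (ε := ε) hp hq1 hφc
    (fun v hv => (hasDerivAt_bump (by linarith) hr0.le hr1 hv).sub_const m) hdc hM hmean hε.le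
    hT hT0
  refine ⟨u, u', hu, hu', hu0, ?_⟩
  have hlow := hlower ε
  have hbT : b / T = 1 / q / (1 / q + (1 - 1 / p)) := by
    rw [hTb]
    have : 0 < 1 / q + (1 - 1 / p) := by positivity
    have : 0 < 1 + q * (1 - 1 / p) := by positivity
    rw [div_eq_div_iff (by positivity) (by positivity)]
    field_simp
  have hAT : A / T = (1 - 1 / p) / (1 / q + (1 - 1 / p)) := by
    rw [hAb, mul_div_assoc, hbT]
    field_simp
  rw [← hbT, ← hAT] at hschmidt
  have hβ0 : 0 ≤ β := by
    have : 0 < q * (q - 1) := by nlinarith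
    have hr' : 0 < 1 / p * q * (q - 1) := by rw [mul_assoc]; positivity
    exact (pos_of_mul_pos_right (hα0.trans_lt hsec) hr'.le).le
  have hc0 : 0 < c := lt_trans (by nlinarith) hc
  have hA' : 0 ≤ ∫ v in Ioo (-1 : ℝ) 1,
      |1 + ε * bumpDeriv q (1 / p) v| ^ p * weight q v * weight q v ^ (-(1 / p)) :=
    setIntegral_nonneg measurableSet_Ioo fun v hv => by
      have := weight_pos hq0 hv
      positivity
  rw [huq, hup']
  exact mul_rpow_lt_rpow_of_perturbation hp0 hq0 hC hT0 hA0 hb0 (sq_nonneg ε)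
    (mul_nonneg hc0.le hα0) (mul_nonneg (by nlinarith) hβ0) hschmidt hA'
    (hup.trans_eq (by ring)) ((show _ = _ by ring).trans_le hlow) hlt

/-- **The supercritical regime `q > 3p`** of the one-dimensional Poincaré-type inequality
for zero-mean functions: the sharp constant in
`‖u - ∫₀¹u‖_{L^q} ≤ C ‖u'‖_{L^p}` over continuously differentiable `u : [0,1] → ℝ`
is strictly greater than `C₁(p,q)`; in particular there is a continuously differentiable
`u` with zero mean for which the inequality with constant `C₁(p,q)` fails. -/
theorem poincare_one_dim_zero_mean_supercritical (p q : ℝ) (hp : 1 < p) (hq : 1 ≤ q)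
    (hq3p : q > 3 * p) :
    schmidtC p q <
      sInf {C : ℝ | ∀ u u' : ℝ → ℝ,
        (∀ x ∈ Icc (0 : ℝ) 1, HasDerivWithinAt u (u' x) (Icc (0 : ℝ) 1) x) →
        ContinuousOn u' (Icc (0 : ℝ) 1) →
        (∫ x in (0 : ℝ)..1, |u x - ∫ t in (0 : ℝ)..1, u t| ^ q) ^ (1 / q) ≤
          C * (∫ x in (0 : ℝ)..1, |u' x| ^ p) ^ (1 / p)} ∧
    ∃ u u' : ℝ → ℝ,
      (∀ x ∈ Icc (0 : ℝ) 1, HasDerivWithinAt u (u' x) (Icc (0 : ℝ) 1) x) ∧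
      ContinuousOn u' (Icc (0 : ℝ) 1) ∧
      (∫ x in (0 : ℝ)..1, u x) = 0 ∧
      (∫ x in (0 : ℝ)..1, |u x| ^ q) ^ (1 / q) >
        schmidtC p q * (∫ x in (0 : ℝ)..1, |u' x| ^ p) ^ (1 / p) := by
  obtain ⟨u, u', hu, hu', hu0, hlt⟩ := exists_schmidtC_mul_lt hp hq3p
  refine ⟨?_, u, u', hu, hu', hu0, hlt⟩
  have hle := rpow_integral_abs_sub_integral_le hp hq hu hu'
  simp only [hu0, sub_zero] at hle
  have hC := schmidtC_nonneg hp (by linarith : 0 < q)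
  have hpos : 0 < (∫ x in (0 : ℝ)..1, |u' x| ^ p) ^ (1 / p) := by
    by_contra! h
    have h0 : 0 ≤ (∫ x in (0 : ℝ)..1, |u' x| ^ p) ^ (1 / p) :=
      Real.rpow_nonneg (integral_nonneg zero_le_one
        fun x _ => Real.rpow_nonneg (abs_nonneg _) _) _
    have := mul_nonneg hC h0
    linarith
  refine ((lt_div_iff₀ hpos).2 hlt).trans_le (le_csInf ⟨1, fun v v' hv hv' => ?_⟩
    fun C hCmem => ?_)
  · rw [one_mul]
    exact rpow_integral_abs_sub_integral_le hp hq hv hv'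
  · rw [div_le_iff₀ hpos]
    have := hCmem u u' hu hu'
    simpa only [hu0, sub_zero] using this
end

section
/- Let Ω ⊂ ℝⁿ (n ≥ 1) be an open set of finite Lebesgue measure and let 1 ≤ p < ∞. Then there exists a constant C > 0 such that for every smooth function u : ℝⁿ → ℝ with compact support contained in Ω, (∫_Ω |u|^p dx)^{1/p} ≤ C (∫_Ω |∇u|^p dx)^{1/p}. -/
open Real MeasureTheory Set

open scoped ENNReal NNReal

/-- On the line, the supremum of a compactly supported `C¹` function is bounded by the `L¹` norm
of its derivative. -/
lemma eLpNorm_top_le_eLpNorm_one_fderiv {u : EuclideanSpace ℝ (Fin 1) → ℝ}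
    (hu : ContDiff ℝ 1 u) (h2u : HasCompactSupport u) :
    eLpNorm u ∞ volume ≤ eLpNorm (fderiv ℝ u) 1 volume := by
  let e : ℝ ≃ₗᵢ[ℝ] EuclideanSpace ℝ (Fin 1) := (OrthonormalBasis.singleton (Fin 1) ℝ).repr
  have hv : ContDiff ℝ 1 (u ∘ e) := hu.comp e.contDiff
  have h2v : HasCompactSupport (u ∘ e) := h2u.comp_homeomorph e.toHomeomorph
  have hderiv (t : ℝ) : ‖deriv (u ∘ e) t‖ₑ ≤ ‖fderiv ℝ u (e t)‖ₑ := by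
    have he : HasDerivAt e (e 1) t := by
      simpa using (e.toContinuousLinearEquiv.hasFDerivAt (x := t)).hasDerivAt
    rw [fderiv_comp_deriv _ (hu.differentiable one_ne_zero).differentiableAt
      he.differentiableAt, he.deriv]
    refine (ContinuousLinearMap.le_opENorm _ _).trans_eq ?_
    rw [← ofReal_norm (e 1), e.norm_map]
    simp
  rw [eLpNorm_exponent_top, eLpNorm_one_eq_lintegral_enorm]
  refine eLpNormEssSup_le_of_ae_enorm_bound (.of_forall fun x ↦ ?_)
  calc ‖u x‖ₑ = ‖(u ∘ e) (e.symm x)‖ₑ := by simp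
    _ ≤ ∫⁻ t in Iic (e.symm x), ‖deriv (u ∘ e) t‖ₑ := h2v.enorm_le_lintegral_Ici_deriv hv _
    _ ≤ ∫⁻ t, ‖deriv (u ∘ e) t‖ₑ := setLIntegral_le_lintegral _ _
    _ ≤ ∫⁻ t, ‖fderiv ℝ u (e t)‖ₑ := lintegral_mono hderiv
    _ = ∫⁻ x, ‖fderiv ℝ u x‖ₑ :=
      e.measurePreserving.lintegral_comp_emb e.toHomeomorph.measurableEmbedding
        (fun x ↦ ‖fderiv ℝ u x‖ₑ)

/-- For every `1 ≤ p < ∞` there are exponents `q ≤ p ≤ r` for which a Sobolev inequality from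
`W^{1,q}` to `L^r` holds on `ℝⁿ`. -/
lemma exists_eLpNorm_le_eLpNorm_fderiv {n : ℕ} (hn : 1 ≤ n) {p : ℝ≥0} (hp : 1 ≤ p) :
    ∃ q r : ℝ≥0∞, q ≤ p ∧ p ≤ r ∧ ∃ C : ℝ≥0, ∀ u : EuclideanSpace ℝ (Fin n) → ℝ,
      ContDiff ℝ 1 u → HasCompactSupport u →
        eLpNorm u r volume ≤ C * eLpNorm (fderiv ℝ u) q volume := by
  obtain rfl | hn2 := hn.eq_or_lt
  · exact ⟨1, ∞, mod_cast hp, le_top, 1, fun u hu h2u ↦ by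
      simpa using eLpNorm_top_le_eLpNorm_one_fderiv hu h2u⟩
  have hn2' : (2 : ℝ≥0) ≤ n := mod_cast hn2
  have hp0 : 0 < p := one_pos.trans_le hp
  have hn0 : (0 : ℝ≥0) < n := two_pos.trans_le hn2'
  set a : ℝ≥0 := min 1 (p⁻¹ + (n : ℝ≥0)⁻¹) with ha
  have hna : (n : ℝ≥0)⁻¹ < a :=
    lt_min (inv_lt_one_of_one_lt₀ (one_lt_two.trans_le hn2')) (lt_add_of_pos_left _ (by positivity))
  have hpa : p⁻¹ ≤ a := le_min (inv_le_one_of_one_le₀ hp) le_self_add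
  have ha0 : 0 < a := pos_of_gt hna
  have hsub : 0 < a - (n : ℝ≥0)⁻¹ := tsub_pos_of_lt hna
  refine ⟨(a⁻¹ : ℝ≥0), ((a - (n : ℝ≥0)⁻¹)⁻¹ : ℝ≥0), ?_, ?_,
    SNormLESNormFDerivOfEqConst ℝ (volume : Measure (EuclideanSpace ℝ (Fin n))) (a⁻¹ : ℝ≥0),
    fun u hu h2u ↦ ?_⟩
  · exact mod_cast inv_le_of_inv_le₀ hp0 hpa
  · norm_cast
    rw [le_inv_comm₀ hp0 hsub, tsub_le_iff_right]
    exact min_le_right _ _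
  · refine eLpNorm_le_eLpNorm_fderiv_of_eq volume hu h2u
      ((one_le_inv₀ ha0).2 (min_le_left _ _)) (by rw [finrank_euclideanSpace_fin]; exact hn) ?_
    rw [NNReal.coe_inv, inv_inv, NNReal.coe_sub hna.le]
    simp

/-- On a finite measure space, `L^q` embeds into `L^p` for `p ≤ q`, with a finite constant that does
not depend on the function. -/
lemma exists_eLpNorm_le_mul_eLpNorm {α : Type*} [MeasurableSpace α] (μ : Measure α)
    [IsFiniteMeasure μ] {p q : ℝ≥0∞} (hpq : p ≤ q) :
    ∃ A : ℝ≥0, ∀ (F : Type) [NormedAddCommGroup F] (f : α → F), AEStronglyMeasurable f μ →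
      eLpNorm f p μ ≤ A * eLpNorm f q μ := by
  obtain rfl | hp0 := eq_or_ne p 0
  · exact ⟨0, by simp⟩
  have hexp : 0 ≤ 1 / p.toReal - 1 / q.toReal := by
    obtain rfl | hq := eq_or_ne q ∞
    · simp
    · exact sub_nonneg.2 (one_div_le_one_div_of_le
        (ENNReal.toReal_pos hp0 (ne_top_of_le_ne_top hq hpq)) (ENNReal.toReal_mono hq hpq))
  have hfin : μ univ ^ (1 / p.toReal - 1 / q.toReal) ≠ ∞ :=
    ENNReal.rpow_ne_top_of_nonneg hexp (measure_ne_top μ univ)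
  refine ⟨(μ univ ^ (1 / p.toReal - 1 / q.toReal)).toNNReal, fun F _ f hf ↦ ?_⟩
  rw [ENNReal.coe_toNNReal hfin, mul_comm]
  exact eLpNorm_le_eLpNorm_mul_rpow_measure_univ hpq hf

/-- **The Friedrichs inequality.** If `Ω ⊆ ℝⁿ` (`n ≥ 1`) is open with finite Lebesgue
measure and `1 ≤ p < ∞`, then there is `C > 0` such that every smooth function with
compact support contained in `Ω` satisfies `‖u‖_{L^p(Ω)} ≤ C ‖∇u‖_{L^p(Ω)}`. -/
theorem friedrichs_inequality (n : ℕ) (hn : 1 ≤ n)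
    (Ω : Set (EuclideanSpace ℝ (Fin n))) (hΩopen : IsOpen Ω) (hΩfin : volume Ω < ⊤)
    (p : ℝ) (hp : 1 ≤ p) :
    ∃ C : ℝ, 0 < C ∧
      ∀ u : EuclideanSpace ℝ (Fin n) → ℝ,
        ContDiff ℝ (⊤ : ℕ∞) u → HasCompactSupport u → tsupport u ⊆ Ω →
        (∫ x in Ω, |u x| ^ p) ^ (1 / p) ≤
          C * (∫ x in Ω, ‖fderiv ℝ u x‖ ^ p) ^ (1 / p) := by
  lift p to ℝ≥0 using zero_le_one.trans hp
  replace hp : 1 ≤ p := mod_cast hp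
  have hp0 : (p : ℝ≥0∞) ≠ 0 := mod_cast (one_pos.trans_le hp).ne'
  obtain ⟨q, r, hqp, hpr, C, hC⟩ := exists_eLpNorm_le_eLpNorm_fderiv hn hp
  have : IsFiniteMeasure (volume.restrict Ω) := ⟨by simpa using hΩfin⟩
  obtain ⟨A, hA⟩ := exists_eLpNorm_le_mul_eLpNorm (volume.restrict Ω) hpr
  obtain ⟨B, hB⟩ := exists_eLpNorm_le_mul_eLpNorm (volume.restrict Ω) hqp
  refine ⟨A * C * B + 1, by positivity, fun u hu h2u hsub ↦ ?_⟩
  have hu1 : ContDiff ℝ 1 u := hu.of_le (mod_cast le_top)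
  have hcont' : Continuous (fderiv ℝ u) := hu1.continuous_fderiv one_ne_zero
  have hmem : MemLp u p (volume.restrict Ω) :=
    (hu1.continuous.memLp_of_hasCompactSupport h2u).restrict _
  have hmem' : MemLp (fderiv ℝ u) p (volume.restrict Ω) :=
    (hcont'.memLp_of_hasCompactSupport (h2u.fderiv ℝ)).restrict _
  have key : eLpNorm u p (volume.restrict Ω) ≤
      ((A * C * B + 1 : ℝ≥0) : ℝ≥0∞) * eLpNorm (fderiv ℝ u) p (volume.restrict Ω) := calc
    eLpNorm u p (volume.restrict Ω)
    _ ≤ A * eLpNorm u r (volume.restrict Ω) := hA _ u hmem.1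
    _ ≤ A * eLpNorm u r volume := by gcongr; exact Measure.restrict_le_self
    _ ≤ A * (C * eLpNorm (fderiv ℝ u) q volume) := by gcongr; exact hC u hu1 h2u
    _ = A * (C * eLpNorm (fderiv ℝ u) q (volume.restrict Ω)) := by
      rw [eLpNorm_restrict_eq_of_support_subset (f := fderiv ℝ u)
        ((support_fderiv_subset ℝ).trans hsub)]
    _ ≤ A * (C * (B * eLpNorm (fderiv ℝ u) p (volume.restrict Ω))) := by
      gcongr; exact hB _ _ hmem'.1
    _ = ((A * C * B : ℝ≥0) : ℝ≥0∞) * eLpNorm (fderiv ℝ u) p (volume.restrict Ω) := by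
      push_cast; ring
    _ ≤ _ := by gcongr; exact le_self_add
  have hreal := ENNReal.toReal_mono
    (ENNReal.mul_ne_top ENNReal.coe_ne_top hmem'.eLpNorm_ne_top) key
  rw [hmem.eLpNorm_eq_integral_rpow_norm hp0 ENNReal.coe_ne_top,
    hmem'.eLpNorm_eq_integral_rpow_norm hp0 ENNReal.coe_ne_top, ENNReal.toReal_mul,
    ENNReal.toReal_ofReal (by positivity), ENNReal.toReal_ofReal (by positivity)] at hreal
  simpa only [norm_eq_abs, ENNReal.coe_toReal, NNReal.coe_add, NNReal.coe_mul, NNReal.coe_one,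
    one_div] using hreal
end

section
/- There exists a bounded connected open set Ω ⊂ ℝ² such that the Poincaré inequality fails on Ω for p = q = 2: for every constant C > 0 there exists a smooth function u : Ω → ℝ with finite Dirichlet integral ∫_Ω |∇u|² dx < ∞ such that ∫_Ω |u − ⟨u⟩|² dx > C ∫_Ω |∇u|² dx, where ⟨u⟩ = (∫_Ω u dx)/meas₂(Ω). -/
open Real MeasureTheory Set

/-- The open rectangle `(a, b) × (c, d)`. -/
def openRect (a b c d : ℝ) : Set (EuclideanSpace ℝ (Fin 2)) :=
  {x | (a < x 0 ∧ x 0 < b) ∧ c < x 1 ∧ x 1 < d}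

theorem isOpen_openRect (a b c d : ℝ) : IsOpen (openRect a b c d) := by
  have key (i : Fin 2) (s t : ℝ) :
      IsOpen {x : EuclideanSpace ℝ (Fin 2) | s < x i ∧ x i < t} :=
    isOpen_Ioo.preimage (by fun_prop : Continuous fun x : EuclideanSpace ℝ (Fin 2) => x i)
  exact (key 0 a b).inter (key 1 c d)

theorem convex_openRect (a b c d : ℝ) : Convex ℝ (openRect a b c d) := by
  have key (i : Fin 2) (s t : ℝ) :
      Convex ℝ {x : EuclideanSpace ℝ (Fin 2) | s < x i ∧ x i < t} :=
    (convex_Ioo s t).linear_preimage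
      (EuclideanSpace.proj i : EuclideanSpace ℝ (Fin 2) →L[ℝ] ℝ).toLinearMap
  exact (key 0 a b).inter (key 1 c d)

theorem volume_openRect (a b c d : ℝ) :
    volume (openRect a b c d) = ENNReal.ofReal (b - a) * ENNReal.ofReal (d - c) := by
  have h : openRect a b c d = (MeasurableEquiv.toLp 2 (Fin 2 → ℝ)).symm ⁻¹'
      Set.pi univ (fun i => Ioo (![a, c] i) (![b, d] i)) := by
    ext x
    simp [openRect, Fin.forall_fin_two]
  rw [h, (EuclideanSpace.volume_preserving_symm_measurableEquiv_toLp (Fin 2)).measure_preimage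
    (MeasurableSet.univ_pi fun i => measurableSet_Ioo).nullMeasurableSet, Real.volume_pi_Ioo]
  simp

theorem volume_real_openRect {a b c d : ℝ} (hab : a ≤ b) (hcd : c ≤ d) :
    volume.real (openRect a b c d) = (b - a) * (d - c) := by
  simp [Measure.real, volume_openRect, hab, hcd]

/-- The left endpoint of the `n`-th room. -/
noncomputable def roomLeft (n : ℕ) : ℝ := (1 / 2) ^ (n + 1)

theorem roomLeft_pos (n : ℕ) : 0 < roomLeft n := by unfold roomLeft; positivity

theorem roomLeft_le_half (n : ℕ) : roomLeft n ≤ 1 / 2 := by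
  unfold roomLeft
  rw [pow_succ]
  have : (1 / 2 : ℝ) ^ n ≤ 1 := pow_le_one₀ (by norm_num) (by norm_num)
  linarith

theorem two_mul_roomLeft_le {m n : ℕ} (h : m < n) : 2 * roomLeft n ≤ roomLeft m := by
  have : (1 / 2 : ℝ) ^ n ≤ (1 / 2) ^ (m + 1) :=
    pow_le_pow_of_le_one (by norm_num) (by norm_num) h
  unfold roomLeft
  rw [pow_succ (1 / 2 : ℝ) n]
  linarith

theorem roomInterval_unique {m n : ℕ} {t : ℝ} (hm : roomLeft m < t ∧ t < 2 * roomLeft m)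
    (hn : roomLeft n < t ∧ t < 2 * roomLeft n) : m = n := by
  rcases lt_trichotomy m n with h | h | h
  · linarith [two_mul_roomLeft_le h]
  · exact h
  · linarith [two_mul_roomLeft_le h]

/-- The `n`-th passage, running from the base square through the `n`-th room. -/
def passage (n : ℕ) : Set (EuclideanSpace ℝ (Fin 2)) :=
  openRect (roomLeft n) (roomLeft n + roomLeft n ^ 2) 0 3

/-- The `n`-th room. -/
def room (n : ℕ) : Set (EuclideanSpace ℝ (Fin 2)) :=
  openRect (roomLeft n) (2 * roomLeft n) 2 3

/-- The base square, from which all passages start. -/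
def baseSquare : Set (EuclideanSpace ℝ (Fin 2)) := openRect 0 1 0 1

/-- Nikodým's domain: a square with infinitely many rooms attached through thin passages. -/
def nikodymDomain : Set (EuclideanSpace ℝ (Fin 2)) :=
  ⋃ n, (baseSquare ∪ passage n) ∪ room n

theorem passage_interval {n : ℕ} {x : EuclideanSpace ℝ (Fin 2)} (h : x ∈ passage n) :
    roomLeft n < x 0 ∧ x 0 < 2 * roomLeft n := by
  obtain ⟨⟨h1, h2⟩, -⟩ := h
  exact ⟨h1, by nlinarith [roomLeft_pos n, roomLeft_le_half n]⟩

theorem baseSquare_subset : baseSquare ⊆ nikodymDomain := fun _ hx =>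
  mem_iUnion.2 ⟨0, .inl (.inl hx)⟩

theorem passage_subset (n : ℕ) : passage n ⊆ nikodymDomain := fun _ hx =>
  mem_iUnion.2 ⟨n, .inl (.inr hx)⟩

theorem room_subset (n : ℕ) : room n ⊆ nikodymDomain := fun _ hx =>
  mem_iUnion.2 ⟨n, .inr hx⟩

theorem isOpen_nikodymDomain : IsOpen nikodymDomain :=
  isOpen_iUnion fun _ =>
    ((isOpen_openRect _ _ _ _).union (isOpen_openRect _ _ _ _)).union (isOpen_openRect _ _ _ _)

theorem nikodymDomain_subset_closedBall :
    nikodymDomain ⊆ Metric.closedBall (0 : EuclideanSpace ℝ (Fin 2)) 4 := by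
  intro x hx
  have hcoord : (0 < x 0 ∧ x 0 < 1) ∧ 0 < x 1 ∧ x 1 < 3 := by
    obtain ⟨n, (h | h) | h⟩ := mem_iUnion.1 hx
    · exact ⟨h.1, h.2.1, by linarith [h.2.2]⟩
    · have := passage_interval h
      exact ⟨⟨by linarith [roomLeft_pos n], by linarith [roomLeft_le_half n]⟩, h.2⟩
    · exact ⟨⟨by linarith [h.1.1, roomLeft_pos n], by linarith [h.1.2, roomLeft_le_half n]⟩,
        by linarith [h.2.1], h.2.2⟩
  rw [mem_closedBall_zero_iff, EuclideanSpace.norm_eq, Fin.sum_univ_two]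
  apply Real.sqrt_le_iff.2
  simp only [Real.norm_eq_abs, sq_abs]
  constructor
  · norm_num
  · nlinarith

theorem volume_nikodymDomain_lt_top : volume nikodymDomain < ⊤ :=
  (measure_mono nikodymDomain_subset_closedBall).trans_lt measure_closedBall_lt_top

theorem isConnected_nikodymDomain : IsConnected nikodymDomain := by
  refine ⟨⟨!₂[1 / 2, 1 / 2], baseSquare_subset ?_⟩, ?_⟩
  · norm_num [baseSquare, openRect]
  refine isPreconnected_iUnion ⟨!₂[1 / 2, 1 / 2], mem_iInter.2 fun n => .inl (.inl ?_)⟩ fun n => ?_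
  · norm_num [baseSquare, openRect]
  have h0 := roomLeft_pos n
  have h1 := roomLeft_le_half n
  have h2 : 0 < roomLeft n ^ 2 := by positivity
  have h3 : roomLeft n ^ 2 ≤ roomLeft n / 2 := by nlinarith
  refine IsPreconnected.union !₂[roomLeft n + roomLeft n ^ 2 / 2, 5 / 2] (.inr ?_) ?_
    (IsPreconnected.union !₂[roomLeft n + roomLeft n ^ 2 / 2, 1 / 2] ?_ ?_
      (convex_openRect _ _ _ _).isPreconnected (convex_openRect _ _ _ _).isPreconnected)
    (convex_openRect _ _ _ _).isPreconnected
  all_goals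
    refine ⟨⟨?_, ?_⟩, ?_, ?_⟩ <;> simp <;> linarith

/-- A smooth function of the second coordinate, rising from `0` at height `1` to `1` at
height `2`. -/
noncomputable def heightStep (x : EuclideanSpace ℝ (Fin 2)) : ℝ := smoothTransition (x 1 - 1)

theorem contDiff_heightStep : ContDiff ℝ (⊤ : ℕ∞) heightStep :=
  smoothTransition.contDiff.comp (by fun_prop)

open Classical in
/-- The test function of the `n`-th room: `1` on the room, and `0` away from the room and its
passage. -/
noncomputable def roomCutoff (n : ℕ) (x : EuclideanSpace ℝ (Fin 2)) : ℝ :=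
  if roomLeft n < x 0 ∧ x 0 < 2 * roomLeft n then heightStep x else 0

theorem abs_roomCutoff_le_one (n : ℕ) (x : EuclideanSpace ℝ (Fin 2)) : |roomCutoff n x| ≤ 1 := by
  unfold roomCutoff heightStep
  split_ifs
  · rw [abs_of_nonneg (smoothTransition.nonneg _)]
    exact smoothTransition.le_one _
  · simp

theorem roomCutoff_baseSquare {n : ℕ} {x : EuclideanSpace ℝ (Fin 2)} (hx : x ∈ baseSquare) :
    roomCutoff n x = 0 := by
  unfold roomCutoff heightStep
  split_ifs
  · exact smoothTransition.zero_of_nonpos (by linarith [hx.2.2])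
  · rfl

theorem roomCutoff_room {n : ℕ} {x : EuclideanSpace ℝ (Fin 2)} (hx : x ∈ room n) :
    roomCutoff n x = 1 := by
  rw [roomCutoff, if_pos hx.1]
  exact smoothTransition.one_of_one_le (by linarith [hx.2.1])

open Filter Topology in
theorem roomCutoff_eventuallyEq (n : ℕ) {x : EuclideanSpace ℝ (Fin 2)} (hx : x ∈ nikodymDomain) :
    (∃ c : ℝ, roomCutoff n =ᶠ[𝓝 x] fun _ => c) ∨
      x ∈ passage n ∧ roomCutoff n =ᶠ[𝓝 x] heightStep := by
  obtain ⟨m, (h | h) | h⟩ := mem_iUnion.1 hx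
  · refine .inl ⟨0, ?_⟩
    filter_upwards [(isOpen_openRect _ _ _ _).mem_nhds h] with y hy
    exact roomCutoff_baseSquare hy
  · by_cases hmn : m = n
    · subst hmn
      refine .inr ⟨h, ?_⟩
      filter_upwards [(isOpen_openRect _ _ _ _).mem_nhds h] with y hy
      exact if_pos (passage_interval hy)
    · refine .inl ⟨0, ?_⟩
      filter_upwards [(isOpen_openRect _ _ _ _).mem_nhds h] with y hy
      exact if_neg fun h' => hmn (roomInterval_unique (passage_interval hy) h')
  · by_cases hmn : m = n
    · subst hmn
      refine .inl ⟨1, ?_⟩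
      filter_upwards [(isOpen_openRect _ _ _ _).mem_nhds h] with y hy
      exact roomCutoff_room hy
    · refine .inl ⟨0, ?_⟩
      filter_upwards [(isOpen_openRect _ _ _ _).mem_nhds h] with y hy
      exact if_neg fun h' => hmn (roomInterval_unique hy.1 h')

theorem contDiffOn_roomCutoff (n : ℕ) :
    ContDiffOn ℝ (⊤ : ℕ∞) (roomCutoff n) nikodymDomain := by
  intro x hx
  apply ContDiffAt.contDiffWithinAt
  rcases roomCutoff_eventuallyEq n hx with ⟨c, h⟩ | ⟨-, h⟩
  · exact contDiffAt_const.congr_of_eventuallyEq h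
  · exact contDiff_heightStep.contDiffAt.congr_of_eventuallyEq h

theorem fderiv_roomCutoff_eq_zero (n : ℕ) {x : EuclideanSpace ℝ (Fin 2)}
    (hx : x ∈ nikodymDomain) (hp : x ∉ passage n) : fderiv ℝ (roomCutoff n) x = 0 := by
  rcases roomCutoff_eventuallyEq n hx with ⟨c, h⟩ | ⟨h, -⟩
  · rw [h.fderiv_eq, fderiv_fun_const]
    rfl
  · exact absurd h hp

theorem exists_bound_fderiv_roomCutoff :
    ∃ M : ℝ, 0 < M ∧ ∀ n, ∀ x ∈ nikodymDomain, ‖fderiv ℝ (roomCutoff n) x‖ ≤ M := by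
  obtain ⟨M, hM⟩ :=
    (isCompact_closedBall (0 : EuclideanSpace ℝ (Fin 2)) 4).exists_bound_of_continuousOn
      (contDiff_heightStep.continuous_fderiv (by simp)).continuousOn
  refine ⟨max M 1, by positivity, fun n x hx => ?_⟩
  rcases roomCutoff_eventuallyEq n hx with ⟨c, h⟩ | ⟨-, h⟩
  · rw [h.fderiv_eq, fderiv_fun_const]
    simp
  · rw [h.fderiv_eq]
    exact (hM x (nikodymDomain_subset_closedBall hx)).trans (le_max_left _ _)

theorem integrableOn_nikodymDomain_of_bounded {f : EuclideanSpace ℝ (Fin 2) → ℝ}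
    (hf : ContinuousOn f nikodymDomain) {M : ℝ} (hM : ∀ x ∈ nikodymDomain, |f x| ≤ M) :
    IntegrableOn f nikodymDomain :=
  IntegrableOn.of_bound volume_nikodymDomain_lt_top
    (hf.aestronglyMeasurable isOpen_nikodymDomain.measurableSet) M
    (ae_restrict_of_forall_mem isOpen_nikodymDomain.measurableSet hM)

theorem integrableOn_roomCutoff_sub_sq (n : ℕ) (c : ℝ) :
    IntegrableOn (fun x => (roomCutoff n x - c) ^ 2) nikodymDomain := by
  refine integrableOn_nikodymDomain_of_bounded (M := (1 + |c|) ^ 2)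
    (((contDiffOn_roomCutoff n).continuousOn.sub continuousOn_const).pow 2) fun x _ => ?_
  rw [abs_pow]
  gcongr
  exact (abs_sub _ _).trans (by gcongr; exact abs_roomCutoff_le_one n x)

theorem integrableOn_norm_fderiv_roomCutoff_sq (n : ℕ) :
    IntegrableOn (fun x => ‖fderiv ℝ (roomCutoff n) x‖ ^ 2) nikodymDomain := by
  obtain ⟨M, -, hM⟩ := exists_bound_fderiv_roomCutoff
  refine integrableOn_nikodymDomain_of_bounded (M := M ^ 2)
    (((contDiffOn_roomCutoff n).continuousOn_fderiv_of_isOpen isOpen_nikodymDomain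
      (by simp)).norm.pow 2) fun x hx => ?_
  rw [abs_pow, abs_norm]
  gcongr
  exact hM n x hx

theorem const_mul_volume_le_setIntegral {f : EuclideanSpace ℝ (Fin 2) → ℝ} {k a b c d : ℝ}
    {Ω : Set (EuclideanSpace ℝ (Fin 2))} (hf : IntegrableOn f Ω) (hf0 : ∀ x, 0 ≤ f x)
    (hs : openRect a b c d ⊆ Ω) (hk : ∀ x ∈ openRect a b c d, k ≤ f x) :
    k * volume.real (openRect a b c d) ≤ ∫ x in Ω, f x :=
  (setIntegral_ge_of_const_le_real (isOpen_openRect a b c d).measurableSet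
    (by rw [volume_openRect]; finiteness) hk (hf.mono_set hs)).trans
    (setIntegral_mono_set hf (ae_of_all _ hf0) hs.eventuallyLE)

/-- The `L²`-deviation of the test function of the `n`-th room from any constant is at least a
quarter of the area of that room. -/
theorem roomLeft_div_four_le_integral (n : ℕ) (c : ℝ) :
    roomLeft n / 4 ≤ ∫ x in nikodymDomain, (roomCutoff n x - c) ^ 2 := by
  have h0 := roomLeft_pos n
  have h1 := roomLeft_le_half n
  rcases le_total (1 / 2) c with hc | hc
  · have := const_mul_volume_le_setIntegral (k := 1 / 4) (integrableOn_roomCutoff_sub_sq n c)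
      (fun _ => sq_nonneg _) baseSquare_subset fun x hx => by
        rw [roomCutoff_baseSquare hx]
        nlinarith
    rw [volume_real_openRect (by norm_num) (by norm_num)] at this
    linarith
  · have := const_mul_volume_le_setIntegral (k := 1 / 4) (integrableOn_roomCutoff_sub_sq n c)
      (fun _ => sq_nonneg _) (room_subset n) fun x hx => by
        rw [roomCutoff_room hx]
        nlinarith
    rw [volume_real_openRect (by linarith) (by norm_num)] at this
    linarith

theorem integral_norm_fderiv_roomCutoff_sq_le {M : ℝ} {n : ℕ}
    (hM : ∀ x ∈ nikodymDomain, ‖fderiv ℝ (roomCutoff n) x‖ ≤ M) :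
    ∫ x in nikodymDomain, ‖fderiv ℝ (roomCutoff n) x‖ ^ 2 ≤ M ^ 2 * (3 * roomLeft n ^ 2) := by
  rw [setIntegral_eq_of_subset_of_forall_sdiff_eq_zero isOpen_nikodymDomain.measurableSet
    (passage_subset n) fun x hx => by rw [fderiv_roomCutoff_eq_zero n hx.1 hx.2]; simp]
  have hvol : volume.real (passage n) = 3 * roomLeft n ^ 2 := by
    rw [passage, volume_real_openRect (by nlinarith) (by norm_num)]
    ring
  rw [← hvol]
  refine (Real.le_norm_self _).trans (norm_setIntegral_le_of_norm_le_const
    ((measure_mono (passage_subset n)).trans_lt volume_nikodymDomain_lt_top) fun x hx => ?_)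
  rw [norm_pow, norm_norm]
  gcongr
  exact hM x (passage_subset n hx)

/-- **Nikodým's counterexample (1933).** There is a bounded connected open planar domain
`Ω` on which the Poincaré inequality `‖u - ⟨u⟩‖_{L²(Ω)} ≤ C ‖∇u‖_{L²(Ω)}` fails: for
every `C > 0` there is a smooth function on `Ω` with finite Dirichlet integral whose
`L²`-deviation from its mean value `⟨u⟩ = (∫_Ω u)/meas₂(Ω)` exceeds `C` times its
Dirichlet integral. -/
theorem nikodym_poincare_counterexample :
    ∃ Ω : Set (EuclideanSpace ℝ (Fin 2)),
      IsOpen Ω ∧ Bornology.IsBounded Ω ∧ IsConnected Ω ∧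
      ∀ C : ℝ, 0 < C →
        ∃ u : EuclideanSpace ℝ (Fin 2) → ℝ,
          ContDiffOn ℝ (⊤ : ℕ∞) u Ω ∧
          IntegrableOn u Ω ∧
          IntegrableOn (fun x => (u x - (∫ y in Ω, u y) / (volume Ω).toReal) ^ 2) Ω ∧
          IntegrableOn (fun x => ‖fderiv ℝ u x‖ ^ 2) Ω ∧
          (∫ x in Ω, (u x - (∫ y in Ω, u y) / (volume Ω).toReal) ^ 2) >
            C * ∫ x in Ω, ‖fderiv ℝ u x‖ ^ 2 := by
  refine ⟨nikodymDomain, isOpen_nikodymDomain,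
    Metric.isBounded_closedBall.subset nikodymDomain_subset_closedBall,
    isConnected_nikodymDomain, fun C hC => ?_⟩
  obtain ⟨M, hM0, hM⟩ := exists_bound_fderiv_roomCutoff
  obtain ⟨n, hn⟩ := exists_pow_lt_of_lt_one (show 0 < 1 / (12 * C * M ^ 2) by positivity)
    (show (1 / 2 : ℝ) < 1 by norm_num)
  refine ⟨roomCutoff n, contDiffOn_roomCutoff n,
    integrableOn_nikodymDomain_of_bounded (contDiffOn_roomCutoff n).continuousOn
      fun x _ => abs_roomCutoff_le_one n x,
    integrableOn_roomCutoff_sub_sq n _, integrableOn_norm_fderiv_roomCutoff_sq n, ?_⟩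
  refine lt_of_lt_of_le ?_ (roomLeft_div_four_le_integral n _)
  refine (mul_le_mul_of_nonneg_left (integral_norm_fderiv_roomCutoff_sq_le (hM n))
    hC.le).trans_lt ?_
  have h0 := roomLeft_pos n
  have hlt : roomLeft n < 1 / (12 * C * M ^ 2) := by
    refine lt_of_le_of_lt ?_ hn
    exact pow_le_pow_of_le_one (by norm_num) (by norm_num) n.le_succ
  rw [lt_div_iff₀ (by positivity)] at hlt
  nlinarith
end

section
/- Let n ≥ 2 and let ω_{n−1} = 2π^{n/2}/Γ(n/2) be the (n−1)-dimensional measure of the unit sphere in ℝⁿ. For every smooth compactly supported u : ℝⁿ → ℝ one has (∫_{ℝⁿ} |u|^{n/(n−1)} dx)^{(n−1)/n} ≤ ω_{n−1}^{−1/n} n^{(1−n)/n} ∫_{ℝⁿ} |∇u| dx, and the constant ω_{n−1}^{−1/n} n^{(1−n)/n} is the smallest constant for which this inequality holds for all such u. -/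
open Real MeasureTheory Set

section

open Filter
open scoped ENNReal Pointwise Topology

theorem lintegral_mul_eq_lintegral_Ioi_setLIntegral {α : Type*} [MeasurableSpace α] (μ : Measure α)
    [SFinite μ] {f : α → ℝ≥0∞} (hf : Measurable f) {g : α → ℝ≥0∞} (hg : Measurable g) :
    ∫⁻ x, f x * g x ∂μ = ∫⁻ t in Ioi (0 : ℝ), ∫⁻ x in {x | ENNReal.ofReal t < f x}, g x ∂μ := by
  have hslice : ∀ c : ℝ≥0∞, volume ({t : ℝ | ENNReal.ofReal t < c} ∩ Ioi 0) = c := by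
    intro c
    induction c with
    | top => simp
    | coe c =>
      have : {t : ℝ | ENNReal.ofReal t < (c : ℝ≥0∞)} ∩ Ioi 0 = Ioo 0 (c : ℝ) := by
        ext t
        simp only [mem_inter_iff, mem_ofPred_eq, mem_Ioi, mem_Ioo]
        rw [and_comm]
        refine and_congr_right fun h => ?_
        simp [ENNReal.ofReal_lt_iff_lt_toReal h.le ENNReal.coe_ne_top]
      rw [this]
      simp
  have hm : MeasurableSet {p : α × ℝ | ENNReal.ofReal p.2 < f p.1} :=
    measurableSet_lt (by fun_prop) (by fun_prop)
  calc ∫⁻ x, f x * g x ∂μ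
      = ∫⁻ x, (∫⁻ t in Ioi (0 : ℝ),
          {p : α × ℝ | ENNReal.ofReal p.2 < f p.1}.indicator (fun p => g p.1) (x, t)) ∂μ := by
        refine lintegral_congr fun x => ?_
        have hmx : MeasurableSet {t : ℝ | ENNReal.ofReal t < f x} :=
          measurableSet_lt (by fun_prop) (by fun_prop)
        have : ∀ t, {p : α × ℝ | ENNReal.ofReal p.2 < f p.1}.indicator (fun p => g p.1) (x, t)
            = {t : ℝ | ENNReal.ofReal t < f x}.indicator (fun _ => g x) t := fun t => rfl
        simp_rw [this]
        rw [lintegral_indicator_const hmx, Measure.restrict_apply hmx, hslice, mul_comm]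
    _ = ∫⁻ t in Ioi (0 : ℝ), ∫⁻ x,
          {p : α × ℝ | ENNReal.ofReal p.2 < f p.1}.indicator (fun p => g p.1) (x, t) ∂μ := by
        refine lintegral_lintegral_swap ?_
        exact ((hg.comp measurable_fst).indicator hm).aemeasurable
    _ = _ := by
        refine lintegral_congr fun t => ?_
        rw [← lintegral_indicator (measurableSet_lt measurable_const hf)]
        rfl

theorem lintegral_eq_lintegral_Ioi_measure_lt {α : Type*} [MeasurableSpace α] (μ : Measure α)
    [SFinite μ] {f : α → ℝ≥0∞} (hf : Measurable f) :
    ∫⁻ x, f x ∂μ = ∫⁻ t in Ioi (0 : ℝ), μ {x | ENNReal.ofReal t < f x} := by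
  simpa using lintegral_mul_eq_lintegral_Ioi_setLIntegral μ hf (measurable_const (a := 1))

theorem Real.volume_add_volume_le_of_isCompact {K L : Set ℝ} (hK : IsCompact K) (hL : IsCompact L)
    (hK0 : K.Nonempty) (hL0 : L.Nonempty) : volume K + volume L ≤ volume (K + L) := by
  have h1 : volume K = volume ((fun x => x + sInf L) '' K) := by
    simp
  have h2 : volume L = volume ((fun x => sSup K + x) '' L) := by
    simp
  rw [h1, h2, ← measure_union₀]
  · refine measure_mono (union_subset ?_ ?_)
    · rintro _ ⟨x, hx, rfl⟩
      exact add_mem_add hx (hL.sInf_mem hL0)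
    · rintro _ ⟨x, hx, rfl⟩
      exact add_mem_add (hK.sSup_mem hK0) hx
  · exact (hL.image (by fun_prop)).measurableSet.nullMeasurableSet
  · refine measure_mono_null (t := {sSup K + sInf L}) ?_ (by simp)
    rintro _ ⟨⟨x, hx, rfl⟩, ⟨y, hy, hxy⟩⟩
    have h3 := le_csSup hK.bddAbove hx
    have h4 := csInf_le hL.bddBelow hy
    simp only [mem_singleton_iff] at hxy ⊢
    linarith

/-- The one-dimensional Brunn–Minkowski inequality. -/
theorem Real.volume_add_volume_le {A B : Set ℝ} (hA : MeasurableSet A) (hB : MeasurableSet B)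
    (hA0 : A.Nonempty) (hB0 : B.Nonempty) : volume A + volume B ≤ volume (A + B) := by
  obtain ⟨a, ha⟩ := hA0
  obtain ⟨b, hb⟩ := hB0
  rw [hA.measure_eq_iSup_isCompact, hB.measure_eq_iSup_isCompact]
  simp only [iSup_and']
  refine ENNReal.biSup_add_biSup_le' ⟨∅, by simp⟩ ⟨∅, by simp⟩ ?_
  rintro K ⟨hKA, hK⟩ L ⟨hLB, hL⟩
  calc volume K + volume L ≤ volume (insert a K) + volume (insert b L) := by
        gcongr <;> exact subset_insert _ _
    _ ≤ volume (insert a K + insert b L) :=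
        volume_add_volume_le_of_isCompact (hK.insert a) (hL.insert b) (insert_nonempty _ _)
          (insert_nonempty _ _)
    _ ≤ volume (A + B) :=
        measure_mono (add_subset_add (insert_subset ha hKA) (insert_subset hb hLB))

theorem ENNReal.geom_mean_le_arith_mean_of_pos {a b : ℝ} (ha : 0 < a) (hb : 0 < b)
    (hab : a + b = 1) (x y : ℝ≥0∞) :
    x ^ a * y ^ b ≤ ENNReal.ofReal a * x + ENNReal.ofReal b * y := by
  have h := ENNReal.young_inequality (x ^ a) (y ^ b) (p := a⁻¹) (q := b⁻¹)
    (Real.HolderConjugate.inv_inv ha hb hab)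
  rw [← ENNReal.rpow_mul, ← ENNReal.rpow_mul, mul_inv_cancel₀ ha.ne', mul_inv_cancel₀ hb.ne',
    ENNReal.ofReal_inv_of_pos ha, ENNReal.ofReal_inv_of_pos hb] at h
  simpa [div_eq_mul_inv, mul_comm] using h

theorem prekopa_leindler_real_of_iSup_eq_one {a b : ℝ} (ha : 0 < a) (hb : 0 < b) (hab : a + b = 1)
    {f g h : ℝ → ℝ≥0∞} (hf : Measurable f) (hg : Measurable g) (hh : Measurable h)
    (hf1 : ⨆ x, f x = 1) (hg1 : ⨆ x, g x = 1)
    (H : ∀ x y, f x ^ a * g y ^ b ≤ h (a * x + b * y)) :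
    (∫⁻ x, f x) ^ a * (∫⁻ x, g x) ^ b ≤ ∫⁻ x, h x := by
  refine (ENNReal.geom_mean_le_arith_mean_of_pos ha hb hab _ _).trans ?_
  rw [lintegral_eq_lintegral_Ioi_measure_lt _ hf, lintegral_eq_lintegral_Ioi_measure_lt _ hg,
    lintegral_eq_lintegral_Ioi_measure_lt _ hh, ← lintegral_const_mul' _ _ (by simp),
    ← lintegral_const_mul' _ _ (by simp)]
  have hmeas : ∀ f : ℝ → ℝ≥0∞, Measurable fun t : ℝ => volume {x | ENNReal.ofReal t < f x} := by
    intro f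
    refine Antitone.measurable fun s t hst => measure_mono fun x hx => ?_
    exact (ENNReal.ofReal_le_ofReal hst).trans_lt hx
  rw [← lintegral_add_left ((hmeas f).const_mul _)]
  refine setLIntegral_mono (hmeas h) fun t ht => ?_
  rcases lt_or_ge t 1 with ht1 | ht1
  · have ht1' : ENNReal.ofReal t < 1 := by simpa using ht1
    obtain ⟨x₀, hx₀⟩ := lt_iSup_iff.1 (hf1 ▸ ht1')
    obtain ⟨y₀, hy₀⟩ := lt_iSup_iff.1 (hg1 ▸ ht1')
    have hA : MeasurableSet {x | ENNReal.ofReal t < f x} := measurableSet_lt measurable_const hf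
    have hB : MeasurableSet {x | ENNReal.ofReal t < g x} := measurableSet_lt measurable_const hg
    have hsub : a • {x | ENNReal.ofReal t < f x} + b • {x | ENNReal.ofReal t < g x}
        ⊆ {x | ENNReal.ofReal t < h x} := by
      rintro _ ⟨_, ⟨x, hx, rfl⟩, _, ⟨y, hy, rfl⟩, rfl⟩
      refine lt_of_lt_of_le ?_ (H x y)
      have ht0 : ENNReal.ofReal t ≠ 0 := by simpa using ht
      calc ENNReal.ofReal t = ENNReal.ofReal t ^ a * ENNReal.ofReal t ^ b := by
            rw [← ENNReal.rpow_add _ _ ht0 ENNReal.ofReal_ne_top, hab, ENNReal.rpow_one]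
        _ < f x ^ a * g y ^ b :=
            ENNReal.mul_lt_mul (ENNReal.rpow_lt_rpow hx ha) (ENNReal.rpow_lt_rpow hy hb)
    refine le_trans ?_ (measure_mono hsub)
    refine le_trans (le_of_eq ?_) (Real.volume_add_volume_le (hA.const_smul₀ a) (hB.const_smul₀ b)
      ⟨_, x₀, hx₀, rfl⟩ ⟨_, y₀, hy₀, rfl⟩)
    simp [Measure.addHaar_smul, abs_of_pos ha, abs_of_pos hb]
  · have hempty : ∀ f : ℝ → ℝ≥0∞, ⨆ x, f x = 1 → {x | ENNReal.ofReal t < f x} = ∅ := by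
      intro f hf1
      ext x
      have h1 : f x ≤ 1 := hf1 ▸ le_iSup f x
      simpa using h1.trans (by simpa using ht1)
    simp [hempty f hf1, hempty g hg1]

theorem prekopa_leindler_real_of_bounded {a b : ℝ} (ha : 0 < a) (hb : 0 < b) (hab : a + b = 1)
    {f g h : ℝ → ℝ≥0∞} (hf : Measurable f) (hg : Measurable g) (hh : Measurable h)
    (hf1 : ⨆ x, f x ≠ ⊤) (hg1 : ⨆ x, g x ≠ ⊤)
    (H : ∀ x y, f x ^ a * g y ^ b ≤ h (a * x + b * y)) :
    (∫⁻ x, f x) ^ a * (∫⁻ x, g x) ^ b ≤ ∫⁻ x, h x := by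
  set F := ⨆ x, f x with hF
  set G := ⨆ x, g x with hG
  rcases eq_or_ne F 0 with hF0 | hF0
  · have : ∀ x, f x = 0 := fun x => le_zero_iff.1 (hF0 ▸ le_iSup f x)
    simp [this, ENNReal.zero_rpow_of_pos ha]
  rcases eq_or_ne G 0 with hG0 | hG0
  · have : ∀ x, g x = 0 := fun x => le_zero_iff.1 (hG0 ▸ le_iSup g x)
    simp [this, ENNReal.zero_rpow_of_pos hb]
  have key := prekopa_leindler_real_of_iSup_eq_one ha hb hab (f := fun x => F⁻¹ * f x)
    (g := fun x => G⁻¹ * g x) (h := fun x => (F⁻¹ ^ a * G⁻¹ ^ b) * h x)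
    (hf.const_mul _) (hg.const_mul _) (hh.const_mul _)
    (by rw [← ENNReal.mul_iSup, ← hF, ENNReal.inv_mul_cancel hF0 hf1])
    (by rw [← ENNReal.mul_iSup, ← hG, ENNReal.inv_mul_cancel hG0 hg1])
    (by
      intro x y
      rw [ENNReal.mul_rpow_of_nonneg _ _ ha.le, ENNReal.mul_rpow_of_nonneg _ _ hb.le,
        mul_mul_mul_comm]
      gcongr
      exact H x y)
  rw [lintegral_const_mul _ hf, lintegral_const_mul _ hg, lintegral_const_mul _ hh,
    ENNReal.mul_rpow_of_nonneg _ _ ha.le, ENNReal.mul_rpow_of_nonneg _ _ hb.le,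
    mul_mul_mul_comm] at key
  refine (ENNReal.mul_le_mul_iff_right ?_ ?_).1 key
  · simp [ENNReal.rpow_eq_zero_iff, hf1, hg1, hF0, hG0]
  · simp [ENNReal.mul_eq_top, ENNReal.rpow_eq_top_iff, hf1, hg1, hF0, hG0]

theorem tendsto_lintegral_min_natCast {α : Type*} [MeasurableSpace α] (μ : Measure α)
    {f : α → ℝ≥0∞} (hf : Measurable f) :
    Tendsto (fun m : ℕ => ∫⁻ x, min (f x) m ∂μ) atTop (nhds (∫⁻ x, f x ∂μ)) := by
  refine lintegral_tendsto_of_tendsto_of_monotone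
    (fun m => (hf.min measurable_const).aemeasurable) ?_ ?_
  · exact .of_forall fun x m k hmk => min_le_min_left _ (by exact_mod_cast hmk)
  · refine .of_forall fun x => ?_
    simpa using (tendsto_const_nhds (x := f x)).min ENNReal.tendsto_nat_nhds_top

/-- The one-dimensional Prékopa–Leindler inequality. -/
theorem prekopa_leindler_real {a b : ℝ} (ha : 0 < a) (hb : 0 < b) (hab : a + b = 1)
    {f g h : ℝ → ℝ≥0∞} (hf : Measurable f) (hg : Measurable g) (hh : Measurable h)
    (H : ∀ x y, f x ^ a * g y ^ b ≤ h (a * x + b * y)) :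
    (∫⁻ x, f x) ^ a * (∫⁻ x, g x) ^ b ≤ ∫⁻ x, h x := by
  rcases eq_or_ne (∫⁻ x, f x) 0 with hF | hF
  · simp [hF, ENNReal.zero_rpow_of_pos ha]
  rcases eq_or_ne (∫⁻ x, g x) 0 with hG | hG
  · simp [hG, ENNReal.zero_rpow_of_pos hb]
  have hlim : Tendsto
      (fun m : ℕ => (∫⁻ x, min (f x) m) ^ a * (∫⁻ x, min (g x) m) ^ b) atTop
      (nhds ((∫⁻ x, f x) ^ a * (∫⁻ x, g x) ^ b)) := by
    refine ENNReal.Tendsto.mul ((tendsto_lintegral_min_natCast _ hf).ennrpow_const a) (Or.inl ?_)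
      ((tendsto_lintegral_min_natCast _ hg).ennrpow_const b) (Or.inl ?_)
    · simp [ENNReal.rpow_eq_zero_iff, hF, ha.not_gt]
    · simp [ENNReal.rpow_eq_zero_iff, hG, hb.not_gt]
  refine le_of_tendsto' hlim fun m => ?_
  have hbdd : ∀ f : ℝ → ℝ≥0∞, ⨆ x, min (f x) (m : ℝ≥0∞) ≠ ⊤ := fun f =>
    ((iSup_le fun x => min_le_right _ _).trans_lt (ENNReal.natCast_lt_top m)).ne
  refine prekopa_leindler_real_of_bounded ha hb hab (hf.min measurable_const)
    (hg.min measurable_const) hh (hbdd f) (hbdd g) fun x y => le_trans ?_ (H x y)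
  gcongr <;> exact min_le_left _ _

/-- The Prékopa–Leindler inequality on `ℝⁿ`. -/
theorem prekopa_leindler_pi {a b : ℝ} (ha : 0 < a) (hb : 0 < b) (hab : a + b = 1) (n : ℕ)
    {f g h : (Fin n → ℝ) → ℝ≥0∞} (hf : Measurable f) (hg : Measurable g) (hh : Measurable h)
    (H : ∀ x y, f x ^ a * g y ^ b ≤ h (a • x + b • y)) :
    (∫⁻ x, f x) ^ a * (∫⁻ x, g x) ^ b ≤ ∫⁻ x, h x := by
  induction n with
  | zero =>
    have hvol : volume (univ : Set (Fin 0 → ℝ)) = 1 := by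
      simp [volume_pi, Measure.pi_of_empty _ default]
    simp only [lintegral_unique, hvol, mul_one]
    exact (H _ _).trans_eq (congrArg h (Subsingleton.elim _ _))
  | succ n ih =>
    let e := MeasurableEquiv.piFinSuccAbove (fun _ : Fin (n + 1) => ℝ) 0
    have he : MeasurePreserving e.symm volume volume :=
      (volume_preserving_piFinSuccAbove (fun _ : Fin (n + 1) => ℝ) 0).symm e
    have hesymm : ∀ p, e.symm p = Fin.cons p.1 p.2 := fun p => by
      simp [e, MeasurableEquiv.piFinSuccAbove, Fin.consEquiv]
    have hint : ∀ {f : (Fin (n + 1) → ℝ) → ℝ≥0∞}, Measurable f →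
        ∫⁻ x, f x = ∫⁻ s, ∫⁻ x, f (e.symm (s, x)) := by
      intro f hf
      rw [← he.lintegral_comp hf, Measure.volume_eq_prod]
      exact lintegral_prod _ (hf.comp e.symm.measurable).aemeasurable
    have hm : ∀ {f : (Fin (n + 1) → ℝ) → ℝ≥0∞}, Measurable f →
        Measurable fun p : ℝ × (Fin n → ℝ) => f (e.symm p) :=
      fun hf => hf.comp e.symm.measurable
    rw [hint hf, hint hg, hint hh]
    refine prekopa_leindler_real ha hb hab (hm hf).lintegral_prod_right'
      (hm hg).lintegral_prod_right' (hm hh).lintegral_prod_right' fun s t => ?_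
    refine ih ((hm hf).comp measurable_prodMk_left) ((hm hg).comp measurable_prodMk_left)
      ((hm hh).comp measurable_prodMk_left) fun x y => ?_
    refine (H _ _).trans_eq (congrArg h ?_)
    simp only [hesymm]
    ext i
    refine Fin.cases ?_ (fun j => ?_) i <;> simp

/-- The Brunn–Minkowski inequality for nonempty open sets of finite measure. -/
theorem brunn_minkowski {n : ℕ} (hn : n ≠ 0) {A B : Set (EuclideanSpace ℝ (Fin n))}
    (hA : IsOpen A) (hB : IsOpen B) (hA0 : A.Nonempty) (hB0 : B.Nonempty)
    (hA1 : volume A ≠ ⊤) (hB1 : volume B ≠ ⊤) :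
    ENNReal.ofReal ((volume.real A ^ (1 / n : ℝ) + volume.real B ^ (1 / n : ℝ)) ^ n)
      ≤ volume (A + B) := by
  have hpos : ∀ {S : Set (EuclideanSpace ℝ (Fin n))}, IsOpen S → S.Nonempty → volume S ≠ ⊤ →
      0 < volume.real S ^ (1 / n : ℝ) := fun hS hS0 hS1 =>
    rpow_pos_of_pos (ENNReal.toReal_pos (hS.measure_pos _ hS0).ne' hS1) _
  have hα := hpos hA hA0 hA1
  have hβ := hpos hB hB0 hB1
  have hpow : ∀ {S : Set (EuclideanSpace ℝ (Fin n))}, volume S ≠ ⊤ →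
      volume S = ENNReal.ofReal ((volume.real S ^ (1 / n : ℝ)) ^ n) := by
    intro S hS
    rw [← rpow_natCast, ← rpow_mul measureReal_nonneg, one_div,
      inv_mul_cancel₀ (by exact_mod_cast hn), rpow_one, ofReal_measureReal hS]
  have hAα := hpow hA1
  have hBβ := hpow hB1
  set α := volume.real A ^ (1 / n : ℝ)
  set β := volume.real B ^ (1 / n : ℝ)
  have hS : 0 < α + β := add_pos hα hβ
  have hcomp : ∀ {S : Set (EuclideanSpace ℝ (Fin n))} {c : ℝ}, IsOpen S → 0 < c →
      MeasurableSet ((fun x : Fin n → ℝ => c • WithLp.toLp 2 x) ⁻¹' S) ∧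
      volume ((fun x : Fin n → ℝ => c • WithLp.toLp 2 x) ⁻¹' S)
        = ENNReal.ofReal ((c ^ n)⁻¹) * volume S := by
    intro S c hS hc
    have hS' : MeasurableSet ((fun x => c • x) ⁻¹' S) :=
      (hS.preimage (continuous_const_smul c)).measurableSet
    refine ⟨(PiLp.volume_preserving_toLp (Fin n)).measurable hS', ?_⟩
    have h1 := (PiLp.volume_preserving_toLp (Fin n)).measure_preimage hS'.nullMeasurableSet
    have h2 := Measure.addHaar_preimage_smul volume hc.ne' S
    rw [finrank_euclideanSpace_fin, abs_of_pos (by positivity)] at h2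
    rw [← h2, ← h1]
    rfl
  have key := prekopa_leindler_pi (a := α / (α + β)) (b := β / (α + β)) (by positivity)
    (by positivity) (by field_simp) n
    (measurable_one.indicator (hcomp hA hα).1) (measurable_one.indicator (hcomp hB hβ).1)
    (measurable_one.indicator (hcomp (hA.add_right (t := B)) hS).1) (by
      intro x y
      by_cases hx : α • WithLp.toLp 2 x ∈ A
      swap
      · rw [indicator_of_notMem (by simpa using hx), ENNReal.zero_rpow_of_pos (by positivity)]
        simp
      by_cases hy : β • WithLp.toLp 2 y ∈ B
      swap
      · rw [indicator_of_notMem (a := y) (by simpa using hy),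
          ENNReal.zero_rpow_of_pos (by positivity)]
        simp
      rw [indicator_of_mem (a := x) (by simpa using hx),
        indicator_of_mem (a := y) (by simpa using hy), indicator_of_mem]
      · simp
      · refine ⟨_, hx, _, hy, ?_⟩
        simp only [WithLp.toLp_add, WithLp.toLp_smul, smul_add, smul_smul]
        congr 2 <;> field_simp)
  have hinv : ∀ {c : ℝ}, 0 < c → ENNReal.ofReal ((c ^ n)⁻¹) * ENNReal.ofReal (c ^ n) = 1 := by
    intro c hc
    rw [← ENNReal.ofReal_mul (by positivity), inv_mul_cancel₀ (by positivity), ENNReal.ofReal_one]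
  rw [lintegral_indicator_one (hcomp hA hα).1, lintegral_indicator_one (hcomp hB hβ).1,
    lintegral_indicator_one (hcomp (hA.add_right (t := B)) hS).1, (hcomp hA hα).2, (hcomp hB hβ).2,
    (hcomp hA.add_right hS).2, hAα, hBβ, hinv hα, hinv hβ, ENNReal.one_rpow, ENNReal.one_rpow,
    one_mul] at key
  calc ENNReal.ofReal ((α + β) ^ n) ≤ ENNReal.ofReal ((α + β) ^ n) *
        (ENNReal.ofReal (((α + β) ^ n)⁻¹) * volume (A + B)) := le_mul_of_one_le_right' key
    _ = volume (A + B) := by rw [← mul_assoc, mul_comm (ENNReal.ofReal _), hinv hS, one_mul]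

theorem volume_add_mul_rpow_le_volume_add_ball {n : ℕ} (hn : 2 ≤ n)
    {A : Set (EuclideanSpace ℝ (Fin n))} (hA : IsOpen A) (hA1 : volume A ≠ ⊤) {h : ℝ} (hh : 0 < h) :
    volume A + ENNReal.ofReal h * (ENNReal.ofReal
        (n * volume.real (Metric.ball (0 : EuclideanSpace ℝ (Fin n)) 1) ^ (1 / n : ℝ)) *
        volume A ^ (1 - 1 / n : ℝ)) ≤
      volume (A + Metric.ball 0 h) := by
  have hn0 : n ≠ 0 := by lia
  have hexp : (0 : ℝ) < 1 - 1 / n := by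
    rw [sub_pos, div_lt_one (by positivity)]
    exact_mod_cast hn
  rcases A.eq_empty_or_nonempty with rfl | hA0
  · rw [measure_empty, ENNReal.zero_rpow_of_pos hexp]
    simp
  refine le_trans ?_ (brunn_minkowski hn0 hA Metric.isOpen_ball hA0 ⟨0, by simpa using hh⟩ hA1
    measure_ball_lt_top.ne)
  have hball : volume.real (Metric.ball (0 : EuclideanSpace ℝ (Fin n)) h) ^ (1 / n : ℝ)
      = h * volume.real (Metric.ball (0 : EuclideanSpace ℝ (Fin n)) 1) ^ (1 / n : ℝ) := by
    rw [measureReal_def, Measure.addHaar_ball_of_pos _ _ hh, finrank_euclideanSpace_fin,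
      ENNReal.toReal_mul, ENNReal.toReal_ofReal (by positivity),
      mul_rpow (by positivity) ENNReal.toReal_nonneg, one_div, pow_rpow_inv_natCast hh.le hn0]
    rfl
  have hv : 0 < volume.real A := ENNReal.toReal_pos (hA.measure_pos _ hA0).ne' hA1
  rw [hball]
  set κ := volume.real (Metric.ball (0 : EuclideanSpace ℝ (Fin n)) 1) ^ (1 / n : ℝ)
  conv_lhs => rw [← ofReal_measureReal hA1]
  set v := volume.real A
  rw [ENNReal.ofReal_rpow_of_pos hv, ← ENNReal.ofReal_mul (by positivity),
    ← ENNReal.ofReal_mul (by positivity), ← ENNReal.ofReal_add (by positivity) (by positivity)]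
  refine ENNReal.ofReal_le_ofReal ?_
  set α := v ^ (1 / n : ℝ) with hαdef
  have hα : 0 < α := by positivity
  have hv1 : v = α ^ n := by
    rw [hαdef, one_div, rpow_inv_natCast_pow hv.le hn0]
  have hv2 : v ^ (1 - 1 / n : ℝ) = α ^ n / α := by
    rw [rpow_sub hv, rpow_one, ← hv1]
  have hbern := one_add_mul_le_pow (a := h * κ / α) (by
    have : 0 ≤ h * κ / α := by positivity
    linarith) n
  rw [hv2]
  calc v + h * (n * κ * (α ^ n / α)) = α ^ n * (1 + n * (h * κ / α)) := by
        rw [hv1]; field_simp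
    _ ≤ α ^ n * (1 + h * κ / α) ^ n := by gcongr
    _ = (α + h * κ) ^ n := by rw [← mul_pow]; congr 1; field_simp

/-- The `L^p` norm of a nonnegative function is at most the integral over `t` of the `L^p` norms of
the indicators of its superlevel sets `{t < f}`. -/
theorem lintegral_rpow_rpow_le_lintegral_measure_lt_rpow {α : Type*} [MeasurableSpace α]
    (μ : Measure α) [SFinite μ] {f : α → ℝ≥0∞} (hf : Measurable f) {p q : ℝ}
    (hpq : p.HolderConjugate q) (hfin : ∫⁻ x, f x ^ p ∂μ ≠ ⊤) :
    (∫⁻ x, f x ^ p ∂μ) ^ (1 / p) ≤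
      ∫⁻ t in Ioi (0 : ℝ), μ {x | ENNReal.ofReal t < f x} ^ (1 / p) := by
  set I := ∫⁻ x, f x ^ p ∂μ with hI
  have hq : 0 < 1 / q := by have := hpq.symm.pos; positivity
  rcases eq_or_ne I 0 with hI0 | hI0
  · rw [hI0, ENNReal.zero_rpow_of_pos (by have := hpq.pos; positivity)]
    exact zero_le
  have hsum : 1 / p + 1 / q = 1 := by simpa using hpq.inv_add_inv_eq_one
  have hne : I ^ (1 / q) ≠ 0 := by simp [ENNReal.rpow_eq_zero_iff, hI0, hfin]
  have hnt : I ^ (1 / q) ≠ ⊤ := ENNReal.rpow_ne_top_of_nonneg hq.le hfin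
  have hmul : I ^ (1 / p) * I ^ (1 / q) = I := by
    rw [← ENNReal.rpow_add _ _ hI0 hfin, hsum, ENNReal.rpow_one]
  rw [← ENNReal.mul_le_mul_iff_left hne hnt, hmul,
    ← lintegral_mul_const' _ _ hnt]
  have hfp : ∀ x, f x ^ p = f x * f x ^ (p - 1) := by
    intro x
    nth_rw 2 [← ENNReal.rpow_one (f x)]
    rw [← ENNReal.rpow_add_of_nonneg _ _ zero_le_one hpq.sub_one_pos.le]
    congr 1
    ring
  calc I = ∫⁻ t in Ioi (0 : ℝ), ∫⁻ x in {x | ENNReal.ofReal t < f x}, f x ^ (p - 1) ∂μ := by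
        simp_rw [hI, hfp]
        exact lintegral_mul_eq_lintegral_Ioi_setLIntegral μ hf (hf.pow_const _)
    _ ≤ _ := by
        refine lintegral_mono fun t => ?_
        have hS : MeasurableSet {x | ENNReal.ofReal t < f x} := measurableSet_lt measurable_const hf
        have := ENNReal.lintegral_mul_le_Lp_mul_Lq μ hpq
          (f := {x | ENNReal.ofReal t < f x}.indicator 1) (g := fun x => f x ^ (p - 1))
          (measurable_one.indicator hS).aemeasurable (hf.pow_const _).aemeasurable
        have h1 : ∀ x, ({x | ENNReal.ofReal t < f x}.indicator (1 : α → ℝ≥0∞)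
            * fun x => f x ^ (p - 1)) x
            = {x | ENNReal.ofReal t < f x}.indicator (fun x => f x ^ (p - 1)) x := by
          intro x
          by_cases hx : ENNReal.ofReal t < f x <;> simp [indicator, hx]
        have h2 : ∀ x, ({x | ENNReal.ofReal t < f x}.indicator (1 : α → ℝ≥0∞) x) ^ p
            = {x | ENNReal.ofReal t < f x}.indicator (1 : α → ℝ≥0∞) x := by
          intro x
          by_cases hx : ENNReal.ofReal t < f x <;>
            simp [indicator, hx, ENNReal.zero_rpow_of_pos hpq.pos]
        have h3 : ∀ x, (f x ^ (p - 1)) ^ q = f x ^ p := by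
          intro x
          rw [← ENNReal.rpow_mul, hpq.sub_one_mul_conj]
        simp_rw [h1, h2, h3] at this
        rwa [lintegral_indicator hS, lintegral_indicator_one hS] at this

theorem exists_forall_norm_sub_le_fderiv_add_mul {E F : Type*} [NormedAddCommGroup E] [NormedSpace ℝ E]
    [NormedAddCommGroup F] [NormedSpace ℝ F] {u : E → F} (hu : ContDiff ℝ 1 u)
    (hc : HasCompactSupport u) {ε : ℝ} (hε : 0 < ε) :
    ∃ δ > 0, ∀ x y, dist x y < δ → ‖u x - u y‖ ≤ (‖fderiv ℝ u y‖ + ε) * ‖x - y‖ := by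
  have huc : UniformContinuous (fderiv ℝ u) :=
    (hc.fderiv ℝ).uniformContinuous_of_continuous (hu.continuous_fderiv one_ne_zero)
  obtain ⟨δ, hδ, H⟩ := Metric.uniformContinuous_iff.1 huc ε hε
  refine ⟨δ, hδ, fun x y hxy => ?_⟩
  refine (convex_ball y δ).norm_image_sub_le_of_norm_fderiv_le (𝕜 := ℝ)
    (fun z _ => (hu.differentiable one_ne_zero) z) (fun z hz => ?_) (Metric.mem_ball_self hδ) hxy
  have h1 := H (Metric.mem_ball.1 hz)
  rw [dist_eq_norm] at h1
  linarith [norm_le_norm_add_norm_sub' (fderiv ℝ u z) (fderiv ℝ u y)]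

/-- The isoperimetric inequality for the superlevel sets of `|u|`, integrated over the levels. -/
theorem lintegral_volume_lt_rpow_le_lintegral_fderiv {n : ℕ} (hn : 2 ≤ n)
    {u : EuclideanSpace ℝ (Fin n) → ℝ} (hu : ContDiff ℝ 1 u) (hc : HasCompactSupport u) :
    ENNReal.ofReal
        (n * volume.real (Metric.ball (0 : EuclideanSpace ℝ (Fin n)) 1) ^ (1 / n : ℝ)) *
      ∫⁻ t in Ioi (0 : ℝ), volume {x | ENNReal.ofReal t < ‖u x‖ₑ} ^ (1 - 1 / n : ℝ)
      ≤ ∫⁻ x, ‖fderiv ℝ u x‖ₑ := by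
  set c := ENNReal.ofReal
    (n * volume.real (Metric.ball (0 : EuclideanSpace ℝ (Fin n)) 1) ^ (1 / n : ℝ))
  set K := Metric.cthickening 1 (tsupport u)
  have hKc : IsCompact K := IsCompact.cthickening hc
  have hKm : MeasurableSet K := hKc.measurableSet
  have hcu : Continuous u := hu.continuous
  have hcdu : Continuous (fderiv ℝ u) := hu.continuous_fderiv one_ne_zero
  have hint : ∫⁻ x, ‖u x‖ₑ ≠ ⊤ := (hcu.integrable_of_hasCompactSupport hc).2.ne
  have hV : Measurable fun t : ℝ => volume {x | ENNReal.ofReal t < ‖u x‖ₑ} :=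
    Antitone.measurable fun s t hst => measure_mono fun x hx =>
      (ENNReal.ofReal_le_ofReal hst).trans_lt hx
  have main : ∀ ε : ℝ, 0 < ε →
      c * ∫⁻ t in Ioi (0 : ℝ), volume {x | ENNReal.ofReal t < ‖u x‖ₑ} ^ (1 - 1 / n : ℝ)
        ≤ (∫⁻ x, ‖fderiv ℝ u x‖ₑ) + ENNReal.ofReal ε * volume K := by
    intro ε hε
    obtain ⟨δ, hδ, H⟩ := exists_forall_norm_sub_le_fderiv_add_mul hu hc hε
    set h := min δ 1
    have hh0 : 0 < h := lt_min hδ one_pos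
    set w : EuclideanSpace ℝ (Fin n) → ℝ≥0∞ := fun x =>
      ‖u x‖ₑ + ENNReal.ofReal h * (‖fderiv ℝ u x‖ₑ + K.indicator (fun _ => ENNReal.ofReal ε) x)
      with hw
    have hwm : Measurable w := by
      have : Measurable (K.indicator fun _ => ENNReal.ofReal ε) := measurable_const.indicator hKm
      fun_prop
    have hsub : ∀ t : ℝ, 0 < t → {x | ENNReal.ofReal t < ‖u x‖ₑ} + Metric.ball 0 h ⊆
        {x | ENNReal.ofReal t < w x} := by
      rintro t ht _ ⟨y, hy, z, hz, rfl⟩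
      rw [mem_ball_zero_iff] at hz
      have hzδ : ‖z‖ < δ := hz.trans_le (min_le_left _ _)
      have hz1 : ‖z‖ < 1 := hz.trans_le (min_le_right _ _)
      have hysupp : y ∈ tsupport u := by
        refine subset_tsupport _ fun h0 => ?_
        simp [h0] at hy
      have hxK : y + z ∈ K :=
        Metric.mem_cthickening_of_dist_le _ y _ _ hysupp (by simpa using hz1.le)
      have h1 := H y (y + z) (by simpa using hzδ)
      have h2 : ‖u y‖ ≤ ‖u (y + z)‖ + h * (‖fderiv ℝ u (y + z)‖ + ε) := by
        have h3 := norm_le_norm_add_norm_sub' (u y) (u (y + z))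
        have h4 : (‖fderiv ℝ u (y + z)‖ + ε) * ‖y - (y + z)‖
            ≤ (‖fderiv ℝ u (y + z)‖ + ε) * h := by
          gcongr
          simpa using hz.le
        linarith
      refine (show ENNReal.ofReal t < ‖u y‖ₑ from hy).trans_le ?_
      have h5 := ENNReal.ofReal_le_ofReal h2
      rw [ENNReal.ofReal_add (by positivity) (by positivity), ENNReal.ofReal_mul hh0.le,
        ENNReal.ofReal_add (by positivity) hε.le, ofReal_norm, ofReal_norm, ofReal_norm] at h5
      simpa only [hw, indicator_of_mem hxK] using h5
    have hopen : ∀ t : ℝ, IsOpen {x | ENNReal.ofReal t < ‖u x‖ₑ} := fun t =>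
      isOpen_lt continuous_const hcu.enorm
    have hfin : ∀ t : ℝ, volume {x | ENNReal.ofReal t < ‖u x‖ₑ} ≠ ⊤ := fun t =>
      ((measure_mono fun x hx => subset_tsupport u fun h0 => by simp [h0] at hx).trans_lt
        (hc.isCompact.measure_lt_top (μ := volume))).ne
    have hle : (∫⁻ x, ‖u x‖ₑ) + ENNReal.ofReal h *
        (c * ∫⁻ t in Ioi (0 : ℝ), volume {x | ENNReal.ofReal t < ‖u x‖ₑ} ^ (1 - 1 / n : ℝ))
        ≤ (∫⁻ x, ‖u x‖ₑ) + ENNReal.ofReal h *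
          ((∫⁻ x, ‖fderiv ℝ u x‖ₑ) + ENNReal.ofReal ε * volume K) := by
      calc _ = ∫⁻ t in Ioi (0 : ℝ), (volume {x | ENNReal.ofReal t < ‖u x‖ₑ} + ENNReal.ofReal h *
            (c * volume {x | ENNReal.ofReal t < ‖u x‖ₑ} ^ (1 - 1 / n : ℝ))) := by
            rw [lintegral_add_left hV, lintegral_const_mul' _ _ ENNReal.ofReal_ne_top,
              lintegral_const_mul' _ _ ENNReal.ofReal_ne_top,
              lintegral_eq_lintegral_Ioi_measure_lt volume hcu.enorm.measurable]
        _ ≤ ∫⁻ t in Ioi (0 : ℝ), volume {x | ENNReal.ofReal t < w x} := by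
            refine setLIntegral_mono' measurableSet_Ioi fun t ht => ?_
            exact (volume_add_mul_rpow_le_volume_add_ball hn (hopen t) (hfin t) hh0).trans
              (measure_mono (hsub t ht))
        _ = ∫⁻ x, w x := (lintegral_eq_lintegral_Ioi_measure_lt volume hwm).symm
        _ = _ := by
            rw [hw, lintegral_add_left hcu.enorm.measurable,
              lintegral_const_mul' _ _ ENNReal.ofReal_ne_top,
              lintegral_add_left hcdu.enorm.measurable, lintegral_indicator_const hKm]
    exact (ENNReal.mul_le_mul_iff_right (by simpa using hh0) ENNReal.ofReal_ne_top).1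
      ((ENNReal.add_le_add_iff_left hint).1 hle)
  have hlim : Tendsto
      (fun ε : ℝ => (∫⁻ x, ‖fderiv ℝ u x‖ₑ) + ENNReal.ofReal ε * volume K)
      (nhdsWithin 0 (Ioi 0)) (nhds (∫⁻ x, ‖fderiv ℝ u x‖ₑ)) := by
    have h1 : Tendsto (fun ε : ℝ => ENNReal.ofReal ε) (nhdsWithin 0 (Ioi 0)) (nhds 0) := by
      simpa using (ENNReal.continuous_ofReal.tendsto 0).mono_left nhdsWithin_le_nhds
    simpa using tendsto_const_nhds.add
      (ENNReal.Tendsto.mul_const h1 (Or.inr hKc.measure_lt_top.ne))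
  exact ge_of_tendsto hlim (eventually_of_mem self_mem_nhdsWithin main)

theorem sobolev_one_of_contDiff {n : ℕ} (hn : 2 ≤ n)
    {u : EuclideanSpace ℝ (Fin n) → ℝ} (hu : ContDiff ℝ 1 u) (hc : HasCompactSupport u) :
    (∫ x, |u x| ^ ((n : ℝ) / ((n : ℝ) - 1))) ^ (((n : ℝ) - 1) / (n : ℝ)) ≤
      (n * volume.real (Metric.ball (0 : EuclideanSpace ℝ (Fin n)) 1) ^ (1 / n : ℝ))⁻¹ *
        ∫ x, ‖fderiv ℝ u x‖ := by
  have hn2 : (2 : ℝ) ≤ n := by exact_mod_cast hn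
  set p : ℝ := n / (n - 1) with hp
  have hp0 : 0 < p := div_pos (by linarith) (by linarith)
  have hpinv : ((n : ℝ) - 1) / n = 1 / p := by rw [hp, one_div_div]
  have hpq : p.HolderConjugate n := by
    rw [Real.holderConjugate_iff]
    refine ⟨by rw [hp, one_lt_div (by linarith)]; linarith, ?_⟩
    rw [hp]
    field_simp
    ring
  have hp1 : (1 - 1 / n : ℝ) = 1 / p := by rw [hp]; field_simp
  have hcp : Continuous fun x => |u x| ^ p :=
    hu.continuous.abs.rpow_const fun x => Or.inr hp0.le
  have hIp : Integrable fun x => |u x| ^ p := by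
    refine hcp.integrable_of_hasCompactSupport (hc.mono fun x hx h0 => hx ?_)
    simp [h0, zero_rpow hp0.ne']
  have hId : Integrable (fderiv ℝ u) :=
    (hu.continuous_fderiv one_ne_zero).integrable_of_hasCompactSupport (hc.fderiv ℝ)
  have hen : ∀ x, ‖(|u x| ^ p)‖ₑ = ‖u x‖ₑ ^ p := by
    intro x
    rw [Real.enorm_rpow_of_nonneg (abs_nonneg _) hp0.le, enorm_abs]
  have hfin : ∫⁻ x, ‖u x‖ₑ ^ p ≠ ⊤ := by
    simpa only [hen] using hIp.2.ne
  have h1 := lintegral_rpow_rpow_le_lintegral_measure_lt_rpow volume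
    hu.continuous.enorm.measurable hpq hfin
  have h2 := lintegral_volume_lt_rpow_le_lintegral_fderiv hn hu hc
  rw [hp1] at h2
  set κ := n * volume.real (Metric.ball (0 : EuclideanSpace ℝ (Fin n)) 1) ^ (1 / n : ℝ)
  have hκ : 0 < κ := mul_pos (by linarith) (rpow_pos_of_pos (ENNReal.toReal_pos
    (Metric.measure_ball_pos _ _ one_pos).ne' measure_ball_lt_top.ne) _)
  have h3 := ENNReal.toReal_mono hId.2.ne ((mul_le_mul_right h1 _).trans h2)
  rw [ENNReal.toReal_mul, ENNReal.toReal_ofReal hκ.le, ← ENNReal.toReal_rpow] at h3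
  have e1 : ∫ x, |u x| ^ p = (∫⁻ x, ‖u x‖ₑ ^ p).toReal := by
    simp_rw [← hen]
    rw [← integral_norm_eq_lintegral_enorm hIp.1]
    exact integral_congr_ae (.of_forall fun x => (norm_of_nonneg (by positivity)).symm)
  have e2 : ∫ x, ‖fderiv ℝ u x‖ = (∫⁻ x, ‖fderiv ℝ u x‖ₑ).toReal :=
    integral_norm_eq_lintegral_enorm hId.1
  rw [hpinv, e1, e2, inv_mul_eq_div, le_div_iff₀' hκ]
  exact h3

/-- A smooth profile equal to `1` on `(-∞, 1]` and to `0` on `[1 + ε, ∞)`. -/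
noncomputable def cutoffProfile (ε s : ℝ) : ℝ := Real.smoothTransition ((1 + ε - s) / ε)

section cutoffProfile

variable {ε : ℝ}

theorem cutoffProfile_contDiff (ε : ℝ) : ContDiff ℝ (⊤ : ℕ∞) (cutoffProfile ε) :=
  Real.smoothTransition.contDiff.comp (by fun_prop)

theorem cutoffProfile_of_le_one (hε : 0 < ε) {s : ℝ} (hs : s ≤ 1) : cutoffProfile ε s = 1 :=
  Real.smoothTransition.one_of_one_le (by rw [one_le_div hε]; linarith)

theorem cutoffProfile_of_one_add_le (hε : 0 < ε) {s : ℝ} (hs : 1 + ε ≤ s) :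
    cutoffProfile ε s = 0 :=
  Real.smoothTransition.zero_of_nonpos (div_nonpos_of_nonpos_of_nonneg (by linarith) hε.le)

theorem cutoffProfile_antitone (hε : 0 < ε) : Antitone (cutoffProfile ε) := fun s t hst =>
  Real.smoothTransition.monotone (by gcongr)

theorem deriv_cutoffProfile_of_lt (hε : 0 < ε) {s : ℝ} (hs : 1 + ε < s) :
    deriv (cutoffProfile ε) s = 0 := by
  have h : cutoffProfile ε =ᶠ[𝓝 s] fun _ => 0 :=
    eventually_of_mem (Ioi_mem_nhds hs) fun t ht => cutoffProfile_of_one_add_le hε (le_of_lt ht)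
  rw [h.deriv_eq, deriv_const]

theorem continuous_deriv_cutoffProfile (ε : ℝ) : Continuous (deriv (cutoffProfile ε)) :=
  (cutoffProfile_contDiff ε).continuous_deriv (by simp)

theorem integral_pow_mul_abs_deriv_cutoffProfile_le (hε : 0 < ε) (k : ℕ) :
    ∫ y in Ioi (0 : ℝ), y ^ k • |deriv (cutoffProfile ε) y| ≤ (1 + ε) ^ k := by
  have hcont := continuous_deriv_cutoffProfile ε
  have hsub : ∫ y in Ioc 0 (1 + ε), y ^ k • |deriv (cutoffProfile ε) y| =
      ∫ y in Ioi (0 : ℝ), y ^ k • |deriv (cutoffProfile ε) y| := by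
    refine (setIntegral_eq_of_subset_of_forall_sdiff_eq_zero measurableSet_Ioi
      (fun y hy => hy.1) fun y hy => ?_).symm
    have : 1 + ε < y := by
      by_contra! h
      exact hy.2 ⟨hy.1, h⟩
    simp [deriv_cutoffProfile_of_lt hε this]
  rw [← hsub, ← intervalIntegral.integral_of_le (by linarith)]
  calc ∫ y in 0..(1 + ε), y ^ k • |deriv (cutoffProfile ε) y|
      ≤ ∫ y in 0..(1 + ε), (1 + ε) ^ k * -deriv (cutoffProfile ε) y := by
        refine intervalIntegral.integral_mono_on (by linarith)
          (Continuous.intervalIntegrable (by fun_prop) _ _)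
          (Continuous.intervalIntegrable (by fun_prop) _ _) fun y hy => ?_
        rw [abs_of_nonpos (cutoffProfile_antitone hε).deriv_nonpos, smul_eq_mul]
        have := (cutoffProfile_antitone hε).deriv_nonpos (x := y)
        have := hy.1
        have := hy.2
        gcongr
        linarith
    _ = (1 + ε) ^ k := by
        rw [intervalIntegral.integral_const_mul, intervalIntegral.integral_neg,
          intervalIntegral.integral_deriv_eq_sub
            (fun x _ => (cutoffProfile_contDiff ε).differentiable (by simp) x)
            (hcont.intervalIntegrable _ _),
          cutoffProfile_of_one_add_le hε le_rfl, cutoffProfile_of_le_one hε zero_le_one]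
        ring

theorem cutoffProfile_norm_eventuallyEq_one {E : Type*} [SeminormedAddGroup E] (hε : 0 < ε)
    {x : E} (hx : ‖x‖ < 1) :
    (fun y : E => cutoffProfile ε ‖y‖) =ᶠ[𝓝 x] fun _ => 1 :=
  eventually_of_mem ((isOpen_lt continuous_norm continuous_const).mem_nhds hx)
    fun _ hy => cutoffProfile_of_le_one hε (le_of_lt hy)

variable {E : Type*} [NormedAddCommGroup E] [InnerProductSpace ℝ E]

theorem contDiff_cutoffProfile_norm (hε : 0 < ε) :
    ContDiff ℝ (⊤ : ℕ∞) fun x : E => cutoffProfile ε ‖x‖ := by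
  refine contDiff_iff_contDiffAt.2 fun x => ?_
  rcases eq_or_ne x 0 with rfl | hx
  · exact contDiffAt_const.congr_of_eventuallyEq
      (cutoffProfile_norm_eventuallyEq_one hε (by simp))
  · exact (cutoffProfile_contDiff ε).contDiffAt.comp x (contDiffAt_norm ℝ hx)

theorem norm_fderiv_cutoffProfile_norm_le (hε : 0 < ε) (x : E) :
    ‖fderiv ℝ (fun x : E => cutoffProfile ε ‖x‖) x‖ ≤ |deriv (cutoffProfile ε) ‖x‖| := by
  rcases eq_or_ne x 0 with rfl | hx
  · rw [(cutoffProfile_norm_eventuallyEq_one hε (x := (0 : E)) (by simp)).fderiv_eq]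
    simp
  · have h1 : DifferentiableAt ℝ (fun x : E => ‖x‖) x :=
      (contDiffAt_norm (n := 1) ℝ hx).differentiableAt one_ne_zero
    have h2 := ((cutoffProfile_contDiff ε).differentiable (by simp) ‖x‖).hasDerivAt
    have h3 : fderiv ℝ (fun x : E => cutoffProfile ε ‖x‖) x =
        deriv (cutoffProfile ε) ‖x‖ • fderiv ℝ (fun x : E => ‖x‖) x :=
      (h2.comp_hasFDerivAt x h1.hasFDerivAt).fderiv
    rw [h3, norm_smul, norm_eq_abs]
    refine mul_le_of_le_one_right (abs_nonneg _) ?_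
    simpa using norm_fderiv_le_of_lipschitz ℝ (x₀ := x) (lipschitzWith_one_norm (E := E))

variable [FiniteDimensional ℝ E]

theorem hasCompactSupport_cutoffProfile_norm (hε : 0 < ε) :
    HasCompactSupport fun x : E => cutoffProfile ε ‖x‖ :=
  HasCompactSupport.intro (isCompact_closedBall 0 (1 + ε)) fun x hx =>
    cutoffProfile_of_one_add_le hε (by simpa using (not_le.1 (by simpa using hx)).le)

variable [MeasurableSpace E] [BorelSpace E] (μ : Measure E) [μ.IsAddHaarMeasure]

theorem integral_norm_fderiv_cutoffProfile_norm_le [Nontrivial E] (hε : 0 < ε) :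
    ∫ x, ‖fderiv ℝ (fun x : E => cutoffProfile ε ‖x‖) x‖ ∂μ ≤
      Module.finrank ℝ E * μ.real (Metric.ball 0 1) * (1 + ε) ^ (Module.finrank ℝ E - 1) := by
  have hint : Integrable (fun x : E => |deriv (cutoffProfile ε) ‖x‖|) μ := by
    refine Continuous.integrable_of_hasCompactSupport ?_ ?_
    · have := continuous_deriv_cutoffProfile ε
      fun_prop
    · refine HasCompactSupport.intro (isCompact_closedBall 0 (1 + ε)) fun x hx => ?_
      rw [deriv_cutoffProfile_of_lt hε (by simpa using hx), abs_zero]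
  calc ∫ x, ‖fderiv ℝ (fun x : E => cutoffProfile ε ‖x‖) x‖ ∂μ
      ≤ ∫ x, |deriv (cutoffProfile ε) ‖x‖| ∂μ :=
        integral_mono_of_nonneg (.of_forall fun x => norm_nonneg _) hint
          (.of_forall fun x => norm_fderiv_cutoffProfile_norm_le hε x)
    _ = Module.finrank ℝ E * μ.real (Metric.ball 0 1) *
          ∫ y in Ioi (0 : ℝ), y ^ (Module.finrank ℝ E - 1) • |deriv (cutoffProfile ε) y| := by
        rw [integral_fun_norm_addHaar μ fun y => |deriv (cutoffProfile ε) y|]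
        simp [mul_assoc]
    _ ≤ _ := by
        gcongr
        exact integral_pow_mul_abs_deriv_cutoffProfile_le hε _

theorem measureReal_ball_le_integral_abs_cutoffProfile_norm_rpow (hε : 0 < ε) {p : ℝ}
    (hp : 0 < p) : μ.real (Metric.ball 0 1) ≤ ∫ x : E, |cutoffProfile ε ‖x‖| ^ p ∂μ := by
  rw [← integral_indicator_one Metric.isOpen_ball.measurableSet]
  refine integral_mono_of_nonneg (.of_forall fun x => indicator_nonneg (by simp) x) ?_
    (.of_forall fun x => ?_)
  · refine Continuous.integrable_of_hasCompactSupport ?_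
      ((hasCompactSupport_cutoffProfile_norm hε).mono fun x hx h0 => hx ?_)
    · exact (contDiff_cutoffProfile_norm hε).continuous.abs.rpow_const fun x => Or.inr hp.le
    · simp only [h0, abs_zero, zero_rpow hp.ne']
  · by_cases hx : x ∈ Metric.ball (0 : E) 1
    · rw [mem_ball_zero_iff] at hx
      simp [hx, cutoffProfile_of_le_one hε hx.le]
    · rw [indicator_of_notMem hx]
      positivity

end cutoffProfile

theorem inv_le_of_forall_sobolev_one_le {n : ℕ} (hn : 2 ≤ n) {C : ℝ}
    (hC : ∀ u : EuclideanSpace ℝ (Fin n) → ℝ,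
        ContDiff ℝ (⊤ : ℕ∞) u → HasCompactSupport u →
        (∫ x, |u x| ^ ((n : ℝ) / ((n : ℝ) - 1))) ^ (((n : ℝ) - 1) / (n : ℝ)) ≤
          C * ∫ x, ‖fderiv ℝ u x‖) :
    (n * volume.real (Metric.ball (0 : EuclideanSpace ℝ (Fin n)) 1) ^ (1 / n : ℝ))⁻¹ ≤ C := by
  have hn2 : (2 : ℝ) ≤ n := by exact_mod_cast hn
  have : Nonempty (Fin n) := ⟨⟨0, by lia⟩⟩
  set κ := volume.real (Metric.ball (0 : EuclideanSpace ℝ (Fin n)) 1)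
  have hκ : 0 < κ :=
    ENNReal.toReal_pos (Metric.measure_ball_pos _ _ one_pos).ne' measure_ball_lt_top.ne
  have hq : 0 < ((n : ℝ) - 1) / n := div_pos (by linarith) (by linarith)
  have hlow : ∀ ε : ℝ, 0 < ε → κ ^ (((n : ℝ) - 1) / n) ≤
      C * ∫ x, ‖fderiv ℝ (fun x : EuclideanSpace ℝ (Fin n) => cutoffProfile ε ‖x‖) x‖ := by
    intro ε hε
    refine le_trans ?_ (hC _ (contDiff_cutoffProfile_norm hε)
      (hasCompactSupport_cutoffProfile_norm hε))
    gcongr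
    exact measureReal_ball_le_integral_abs_cutoffProfile_norm_rpow volume hε
      (div_pos (by linarith) (by linarith))
  have hκq : 0 < κ ^ (((n : ℝ) - 1) / n) := rpow_pos_of_pos hκ _
  have hC0 : 0 ≤ C := by
    by_contra! h
    have h1 := hlow 1 one_pos
    have h2 : C * ∫ x, ‖fderiv ℝ (fun x : EuclideanSpace ℝ (Fin n) => cutoffProfile 1 ‖x‖) x‖ ≤ 0 :=
      mul_nonpos_of_nonpos_of_nonneg h.le (integral_nonneg fun x => norm_nonneg _)
    linarith
  have hε : ∀ ε : ℝ, 0 < ε →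
      κ ^ (((n : ℝ) - 1) / n) ≤ C * (n * κ * (1 + ε) ^ (n - 1)) := by
    intro ε hε
    refine (hlow ε hε).trans (mul_le_mul_of_nonneg_left ?_ hC0)
    simpa using integral_norm_fderiv_cutoffProfile_norm_le
      (volume : Measure (EuclideanSpace ℝ (Fin n))) hε
  have hlim : Tendsto (fun ε : ℝ => C * (n * κ * (1 + ε) ^ (n - 1))) (𝓝[>] 0)
      (𝓝 (C * (n * κ))) := by
    have : Continuous fun ε : ℝ => C * (n * κ * (1 + ε) ^ (n - 1)) := by fun_prop
    simpa using (this.tendsto 0).mono_left nhdsWithin_le_nhds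
  have h := ge_of_tendsto hlim (eventually_of_mem self_mem_nhdsWithin hε)
  have hsplit : κ = κ ^ (((n : ℝ) - 1) / n) * κ ^ (1 / n : ℝ) := by
    rw [← rpow_add hκ]
    have : ((n : ℝ) - 1) / n + 1 / n = 1 := by field_simp; ring
    rw [this, rpow_one]
  have hκ1 : 0 < κ ^ (1 / n : ℝ) := rpow_pos_of_pos hκ _
  rw [inv_le_iff_one_le_mul₀ (by positivity)]
  refine le_of_mul_le_mul_left ?_ hκq
  calc κ ^ (((n : ℝ) - 1) / n) * 1 ≤ C * (n * κ) := by simpa using h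
    _ = _ := by nth_rw 1 [hsplit]; ring

theorem sobolev_constant_eq {n : ℕ} (hn : n ≠ 0) :
    (2 * π ^ ((n : ℝ) / 2) / Real.Gamma ((n : ℝ) / 2)) ^ (-(1 / (n : ℝ))) *
        (n : ℝ) ^ ((1 - (n : ℝ)) / (n : ℝ)) =
      (n * volume.real (Metric.ball (0 : EuclideanSpace ℝ (Fin n)) 1) ^ (1 / n : ℝ))⁻¹ := by
  have hn0 : 0 < (n : ℝ) := by positivity
  have : Nonempty (Fin n) := ⟨⟨0, by lia⟩⟩
  have hΓ : 0 < Real.Gamma ((n : ℝ) / 2) := Real.Gamma_pos_of_pos (by positivity)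
  have hvol : volume.real (Metric.ball (0 : EuclideanSpace ℝ (Fin n)) 1) =
      (2 * π ^ ((n : ℝ) / 2) / Real.Gamma ((n : ℝ) / 2)) / n := by
    rw [measureReal_def, EuclideanSpace.volume_ball, Fintype.card_fin,
      Real.Gamma_add_one (by positivity), ENNReal.ofReal_one, one_pow, one_mul,
      ENNReal.toReal_ofReal (by positivity), sqrt_eq_rpow, ← rpow_mul_natCast pi_pos.le]
    field_simp
  rw [hvol]
  set W := 2 * π ^ ((n : ℝ) / 2) / Real.Gamma ((n : ℝ) / 2)
  have hW : 0 < W := by positivity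
  rw [div_rpow hW.le hn0.le, mul_inv, inv_div, rpow_neg hW.le, sub_div, div_self hn0.ne',
    rpow_sub hn0, rpow_one]
  field_simp

end

/-- **The sharp Sobolev inequality for `p = 1`** (Maz'ya 1960; Federer–Fleming 1960).
For `n ≥ 2` and every smooth compactly supported `u : ℝⁿ → ℝ`,
`‖u‖_{L^{n/(n-1)}} ≤ ω_{n-1}^{-1/n} n^{(1-n)/n} ‖∇u‖_{L¹}` with
`ω_{n-1} = 2π^{n/2}/Γ(n/2)`, and this constant is the smallest possible. -/
theorem sobolev_inequality_p_one_sharp (n : ℕ) (hn : 2 ≤ n) :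
    (∀ u : EuclideanSpace ℝ (Fin n) → ℝ,
        ContDiff ℝ (⊤ : ℕ∞) u → HasCompactSupport u →
        (∫ x, |u x| ^ ((n : ℝ) / ((n : ℝ) - 1))) ^ (((n : ℝ) - 1) / (n : ℝ)) ≤
          (2 * π ^ ((n : ℝ) / 2) / Real.Gamma ((n : ℝ) / 2)) ^ (-(1 / (n : ℝ))) *
            (n : ℝ) ^ ((1 - (n : ℝ)) / (n : ℝ)) * ∫ x, ‖fderiv ℝ u x‖) ∧
    (∀ C : ℝ,
      (∀ u : EuclideanSpace ℝ (Fin n) → ℝ,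
        ContDiff ℝ (⊤ : ℕ∞) u → HasCompactSupport u →
        (∫ x, |u x| ^ ((n : ℝ) / ((n : ℝ) - 1))) ^ (((n : ℝ) - 1) / (n : ℝ)) ≤
          C * ∫ x, ‖fderiv ℝ u x‖) →
      (2 * π ^ ((n : ℝ) / 2) / Real.Gamma ((n : ℝ) / 2)) ^ (-(1 / (n : ℝ))) *
        (n : ℝ) ^ ((1 - (n : ℝ)) / (n : ℝ)) ≤ C) := by
  rw [sobolev_constant_eq (by lia)]
  exact ⟨fun u hu hc => sobolev_one_of_contDiff hn (hu.of_le (by exact_mod_cast le_top)) hc,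
    fun C hC => inv_le_of_forall_sobolev_one_le hn hC⟩
end
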